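/- Estimate of the transport term I₁: there exists a constant C > 0 depending only on τ₀ such that, under the standing assumptions, ∑_{n≥0} ∑_{|α|=n} |I^α_1| τⁿ Mₙ / ‖θ ⟨r⟩ⁿ ∂^α_h g‖_{L²} ≤ C τ^{−2} ( ‖g‖_{X_τ} + ‖g‖_{D_τ} ) ‖g‖_{Y_τ}. -/

import Mathlib

open MeasureTheory Filter Set

noncomputable section

/-- `⟨t⟩ = 1 + t` -/
def angT (t : ℝ) : ℝ := 1 + t

/-- `θ_λ(z) = exp (λ z² / (8⟨t⟩))`; `θ = θ₁`. -/
def thw (t lam z : ℝ) : ℝ := Real.exp (lam * z ^ 2 / (8 * angT t))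

/-- `⟨r⟩ = √(x² + y² + 1)` -/
def angR (x y : ℝ) : ℝ := Real.sqrt (x ^ 2 + y ^ 2 + 1)

/-- `Mₙ = (n+1)⁴ / n!` -/
def Mfac (n : ℕ) : ℝ := ((n : ℝ) + 1) ^ 4 / (n.factorial : ℝ)

/-- `∂_x` -/
def pdx (f : ℝ → ℝ → ℝ → ℝ) : ℝ → ℝ → ℝ → ℝ := fun x y z => deriv (fun x' => f x' y z) x
/-- `∂_y` -/
def pdy (f : ℝ → ℝ → ℝ → ℝ) : ℝ → ℝ → ℝ → ℝ := fun x y z => deriv (fun y' => f x y' z) y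
/-- `∂_z` -/
def pdz (f : ℝ → ℝ → ℝ → ℝ) : ℝ → ℝ → ℝ → ℝ := fun x y z => deriv (fun z' => f x y z') z

/-- `∂^α_h = ∂_x^{α₁} ∂_y^{α₂}` for the multi-index `α = (a, b)` -/
def pdh (a b : ℕ) (f : ℝ → ℝ → ℝ → ℝ) : ℝ → ℝ → ℝ → ℝ := pdx^[a] (pdy^[b] f)

/-- `r ∂_r = x ∂_x + y ∂_y` -/
def rdr (f : ℝ → ℝ → ℝ → ℝ) : ℝ → ℝ → ℝ → ℝ := fun x y z => x * pdx f x y z + y * pdy f x y z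

/-- weighted `L²` norm over `ℝ² × (0,∞)` of `θ_λ ⟨r⟩ⁿ f` -/
def L2w (t lam : ℝ) (n : ℕ) (f : ℝ → ℝ → ℝ → ℝ) : ℝ :=
  Real.sqrt (∫ x : ℝ, ∫ y : ℝ, ∫ z in Ioi (0 : ℝ), (thw t lam z * angR x y ^ n * f x y z) ^ 2)

/-- weighted `L²_z` norm at fixed `(x, y)` of `θ_λ ⟨r⟩ⁿ f (x, y, ·)` -/
def L2z (t lam : ℝ) (n : ℕ) (f : ℝ → ℝ → ℝ → ℝ) (x y : ℝ) : ℝ :=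
  Real.sqrt (∫ z in Ioi (0 : ℝ), (thw t lam z * angR x y ^ n * f x y z) ^ 2)

/-- mixed `L^∞_h L²_z` norm of `θ_λ ⟨r⟩ⁿ f` -/
def LIh2z (t lam : ℝ) (n : ℕ) (f : ℝ → ℝ → ℝ → ℝ) : ℝ :=
  Real.sqrt (∫ z in Ioi (0 : ℝ), (⨆ p : ℝ × ℝ, |thw t lam z * angR p.1 p.2 ^ n * f p.1 p.2 z|) ^ 2)

/-- mixed `L²_h L^∞_z` norm of `θ_λ ⟨r⟩ⁿ f` -/
def L2hIz (t lam : ℝ) (n : ℕ) (f : ℝ → ℝ → ℝ → ℝ) : ℝ :=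
  Real.sqrt (∫ x : ℝ, ∫ y : ℝ,
    (⨆ z : Ioi (0 : ℝ), |thw t lam (z : ℝ) * angR x y ^ n * f x y (z : ℝ)|) ^ 2)

/-- the primitive `φ(x,y,z) = exp(−z²/(4⟨t⟩)) ∫₀^z g(x,y,s) exp(s²/(4⟨t⟩)) ds` -/
def phiF (t : ℝ) (g : ℝ → ℝ → ℝ → ℝ) : ℝ → ℝ → ℝ → ℝ := fun x y z =>
  Real.exp (-(z ^ 2) / (4 * angT t)) * ∫ s in (0 : ℝ)..z, g x y s * Real.exp (s ^ 2 / (4 * angT t))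

/-- `u^r = ∂_z φ` -/
def ur (t : ℝ) (g : ℝ → ℝ → ℝ → ℝ) : ℝ → ℝ → ℝ → ℝ := pdz (phiF t g)

/-- `u^z = −(x∂_x + y∂_y)φ − 2φ` -/
def uzv (t : ℝ) (g : ℝ → ℝ → ℝ → ℝ) : ℝ → ℝ → ℝ → ℝ := fun x y z =>
  -(rdr (phiF t g) x y z) - 2 * phiF t g x y z

/-- smoothness together with rapid decay in `z` of all derivatives -/
def DecaySmooth (g : ℝ → ℝ → ℝ → ℝ) : Prop :=
  ContDiff ℝ (⊤ : ℕ∞) (fun p : ℝ × ℝ × ℝ => g p.1 p.2.1 p.2.2) ∧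
  ∀ a b k m : ℕ, ∀ x y : ℝ,
    Tendsto (fun z : ℝ => z ^ m * pdz^[k] (pdh a b g) x y z) atTop (nhds 0)

/-- `θ ⟨r⟩^{|α|} ∂^α_h g ∈ L²(ℝ² × (0,∞))` for every `α` -/
def L2cond (t : ℝ) (g : ℝ → ℝ → ℝ → ℝ) : Prop :=
  ∀ a b : ℕ,
    Integrable
      (fun p : ℝ × ℝ × ℝ =>
        (thw t 1 p.2.2 * angR p.1 p.2.1 ^ (a + b) * pdh a b g p.1 p.2.1 p.2.2) ^ 2)
      (volume.restrict {p : ℝ × ℝ × ℝ | 0 < p.2.2})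

/-- `θ ⟨r⟩^{|α|} ∂^α_h ∂_z g ∈ L²(ℝ² × (0,∞))` for every `α` -/
def L2condZ (t : ℝ) (g : ℝ → ℝ → ℝ → ℝ) : Prop :=
  ∀ a b : ℕ,
    Integrable
      (fun p : ℝ × ℝ × ℝ =>
        (thw t 1 p.2.2 * angR p.1 p.2.1 ^ (a + b) * pdh a b (pdz g) p.1 p.2.1 p.2.2) ^ 2)
      (volume.restrict {p : ℝ × ℝ × ℝ | 0 < p.2.2})

/-- `X_n(g, τ)` -/
def Xel (t τ : ℝ) (g : ℝ → ℝ → ℝ → ℝ) (n : ℕ) : ℝ :=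
  (∑ a ∈ Finset.range (n + 1), L2w t 1 n (pdh a (n - a) g)) * τ ^ n * Mfac n

/-- `D_n(g, τ) = X_n(∂_z g, τ)` -/
def Del (t τ : ℝ) (g : ℝ → ℝ → ℝ → ℝ) (n : ℕ) : ℝ :=
  (∑ a ∈ Finset.range (n + 1), L2w t 1 n (pdh a (n - a) (pdz g))) * τ ^ n * Mfac n

/-- `Y_n(g, τ)` (with `Y₀ = 0`) -/
def Yel (t τ : ℝ) (g : ℝ → ℝ → ℝ → ℝ) (n : ℕ) : ℝ :=
  (∑ a ∈ Finset.range (n + 1), L2w t 1 n (pdh a (n - a) g)) * τ ^ (n - 1) * (n : ℝ) * Mfac n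

/-- `‖g‖_{X_τ}` -/
def Xnrm (t τ : ℝ) (g : ℝ → ℝ → ℝ → ℝ) : ℝ := ∑' n : ℕ, Xel t τ g n
/-- `‖g‖_{D_τ}` -/
def Dnrm (t τ : ℝ) (g : ℝ → ℝ → ℝ → ℝ) : ℝ := ∑' n : ℕ, Del t τ g n
/-- `‖g‖_{Y_τ}` -/
def Ynrm (t τ : ℝ) (g : ℝ → ℝ → ℝ → ℝ) : ℝ := ∑' n : ℕ, Yel t τ g n

/-- triple integral over `ℝ² × (0,∞)` -/
def trip (F : ℝ → ℝ → ℝ → ℝ) : ℝ := ∫ x : ℝ, ∫ y : ℝ, ∫ z in Ioi (0 : ℝ), F x y z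

/-- `I^α_1` -/
def I1 (t : ℝ) (g : ℝ → ℝ → ℝ → ℝ) (a b : ℕ) : ℝ :=
  -trip fun x y z =>
    thw t 2 z * angR x y ^ (2 * (a + b)) *
      pdh a b (fun x' y' z' => ur t g x' y' z' * rdr g x' y' z') x y z * pdh a b g x y z

/-- `I^α_2` -/
def I2 (t : ℝ) (g : ℝ → ℝ → ℝ → ℝ) (a b : ℕ) : ℝ :=
  -trip fun x y z =>
    thw t 2 z * angR x y ^ (2 * (a + b)) *
      pdh a b (fun x' y' z' => uzv t g x' y' z' * pdz g x' y' z') x y z * pdh a b g x y z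

/-- `I^α_3` -/
def I3 (t : ℝ) (g : ℝ → ℝ → ℝ → ℝ) (a b : ℕ) : ℝ :=
  -trip fun x y z =>
    thw t 2 z * angR x y ^ (2 * (a + b)) *
      pdh a b (fun x' y' z' => ur t g x' y' z' ^ 2) x y z * pdh a b g x y z

/-- `I^α_4` -/
def I4 (t : ℝ) (g : ℝ → ℝ → ℝ → ℝ) (a b : ℕ) : ℝ :=
  (1 / (2 * angT t)) * trip fun x y z =>
    thw t 2 z * angR x y ^ (2 * (a + b)) *
      pdh a b
        (fun x' y' z' =>
          uzv t g x' y' z' * pdz (fun x'' y'' w => w * phiF t g x'' y'' w) x' y' z') x y z *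
      pdh a b g x y z

/-- `I^α_5` -/
def I5 (t : ℝ) (g : ℝ → ℝ → ℝ → ℝ) (a b : ℕ) : ℝ :=
  -(1 / angT t) * trip fun x y z =>
    z * thw t 2 z * angR x y ^ (2 * (a + b)) *
      pdh a b (fun x' y' z' => ur t g x' y' z' * phiF t g x' y' z') x y z * pdh a b g x y z

/-- `I^α_6` -/
def I6 (t : ℝ) (g : ℝ → ℝ → ℝ → ℝ) (a b : ℕ) : ℝ :=
  -(1 / (2 * angT t)) * trip fun x y z =>
    z * thw t 2 z * angR x y ^ (2 * (a + b)) *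
      (∫ s in Ioi z, pdh a b (fun x' y' z' => ur t g x' y' z' ^ 2) x y s) * pdh a b g x y z

/-- `I^α_7` -/
def I7 (t : ℝ) (g : ℝ → ℝ → ℝ → ℝ) (a b : ℕ) : ℝ :=
  (1 / angT t) * trip fun x y z =>
    z * thw t 2 z * angR x y ^ (2 * (a + b)) *
      (∫ s in Ioi z, pdh a b (fun x' y' z' => pdz (ur t g) x' y' z' * uzv t g x' y' z') x y s) *
      pdh a b g x y z

/-- `∑_{|α| = n} |I^α| τⁿ Mₙ / ‖θ ⟨r⟩ⁿ ∂^α_h g‖_{L²}` (with the convention `x / 0 = 0`) -/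
def Qterm (t τ : ℝ) (g : ℝ → ℝ → ℝ → ℝ) (I : ℕ → ℕ → ℝ) (n : ℕ) : ℝ :=
  ∑ a ∈ Finset.range (n + 1), |I a (n - a)| * τ ^ n * Mfac n / L2w t 1 n (pdh a (n - a) g)

/-- `∂_t` -/
def pdt (G : ℝ → ℝ → ℝ → ℝ → ℝ) (t x y z : ℝ) : ℝ := deriv (fun t' => G t' x y z) t

/-- the good-unknown axially symmetric Prandtl equation at the point `(t, x, y, z)` -/
def GoodEq (G : ℝ → ℝ → ℝ → ℝ → ℝ) (t x y z : ℝ) : Prop :=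
  pdt G t x y z
      + ur t (G t) x y z * rdr (G t) x y z
      + uzv t (G t) x y z * pdz (G t) x y z
      - pdz (pdz (G t)) x y z
      + G t x y z / angT t
      + ur t (G t) x y z ^ 2
      - 1 / (2 * angT t) * (uzv t (G t) x y z * pdz (fun x' y' w => w * phiF t (G t) x' y' w) x y z)
      + z / angT t * (ur t (G t) x y z * phiF t (G t) x y z)
      + z / (2 * angT t) * (∫ s in Ioi z, ur t (G t) x y s ^ 2)
      - z / angT t * (∫ s in Ioi z, pdz (ur t (G t)) x y s * uzv t (G t) x y s) = 0

/-- Joint smoothness of a function of three real variables. -/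
def SmoothXYZ (f : ℝ → ℝ → ℝ → ℝ) : Prop :=
  ContDiff ℝ (⊤ : ℕ∞) (fun p : ℝ × ℝ × ℝ => f p.1 p.2.1 p.2.2)

theorem one_add_one_le_infty : ((1 : WithTop ℕ∞) + 1) ≤ ((⊤ : ℕ∞) : WithTop ℕ∞) :=
  WithTop.coe_le_coe.2 (le_top (a := ((1 : ℕ∞) + 1)))

namespace SmoothXYZ

variable {f : ℝ → ℝ → ℝ → ℝ}

theorem continuous (hf : SmoothXYZ f) :
    Continuous (fun p : ℝ × ℝ × ℝ => f p.1 p.2.1 p.2.2) :=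
  ContDiff.continuous hf

theorem hasFDerivAt (hf : SmoothXYZ f) (p : ℝ × ℝ × ℝ) :
    HasFDerivAt (fun p : ℝ × ℝ × ℝ => f p.1 p.2.1 p.2.2)
      (fderiv ℝ (fun p : ℝ × ℝ × ℝ => f p.1 p.2.1 p.2.2) p) p :=
  ((ContDiff.differentiable hf (by simp)) p).hasFDerivAt

theorem hasDerivAt_x_fderiv (hf : SmoothXYZ f) (x y z : ℝ) :
    HasDerivAt (fun x' => f x' y z)
      (fderiv ℝ (fun p : ℝ × ℝ × ℝ => f p.1 p.2.1 p.2.2) (x, y, z) (1, 0, 0)) x :=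
  HasFDerivAt.comp_hasDerivAt (f := (fun x' : ℝ => (x', y, z))) x (hf.hasFDerivAt (x, y, z))
    ((hasDerivAt_id x).prodMk (hasDerivAt_const x (y, z)))

theorem hasDerivAt_y_fderiv (hf : SmoothXYZ f) (x y z : ℝ) :
    HasDerivAt (fun y' => f x y' z)
      (fderiv ℝ (fun p : ℝ × ℝ × ℝ => f p.1 p.2.1 p.2.2) (x, y, z) (0, 1, 0)) y :=
  HasFDerivAt.comp_hasDerivAt (f := (fun y' : ℝ => (x, y', z))) y (hf.hasFDerivAt (x, y, z))
    ((hasDerivAt_const y x).prodMk ((hasDerivAt_id y).prodMk (hasDerivAt_const y z)))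

theorem hasDerivAt_z_fderiv (hf : SmoothXYZ f) (x y z : ℝ) :
    HasDerivAt (fun z' => f x y z')
      (fderiv ℝ (fun p : ℝ × ℝ × ℝ => f p.1 p.2.1 p.2.2) (x, y, z) (0, 0, 1)) z :=
  HasFDerivAt.comp_hasDerivAt (f := (fun z' : ℝ => (x, y, z'))) z (hf.hasFDerivAt (x, y, z))
    ((hasDerivAt_const z x).prodMk ((hasDerivAt_const z y).prodMk (hasDerivAt_id z)))

theorem pdx_eq (hf : SmoothXYZ f) (x y z : ℝ) : pdx f x y z =
    fderiv ℝ (fun p : ℝ × ℝ × ℝ => f p.1 p.2.1 p.2.2) (x, y, z) (1, 0, 0) :=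
  (hf.hasDerivAt_x_fderiv x y z).deriv

theorem pdy_eq (hf : SmoothXYZ f) (x y z : ℝ) : pdy f x y z =
    fderiv ℝ (fun p : ℝ × ℝ × ℝ => f p.1 p.2.1 p.2.2) (x, y, z) (0, 1, 0) :=
  (hf.hasDerivAt_y_fderiv x y z).deriv

theorem pdz_eq (hf : SmoothXYZ f) (x y z : ℝ) : pdz f x y z =
    fderiv ℝ (fun p : ℝ × ℝ × ℝ => f p.1 p.2.1 p.2.2) (x, y, z) (0, 0, 1) :=
  (hf.hasDerivAt_z_fderiv x y z).deriv

theorem hasDerivAt_x (hf : SmoothXYZ f) (x y z : ℝ) :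
    HasDerivAt (fun x' => f x' y z) (pdx f x y z) x :=
  hf.pdx_eq x y z ▸ hf.hasDerivAt_x_fderiv x y z

theorem hasDerivAt_y (hf : SmoothXYZ f) (x y z : ℝ) :
    HasDerivAt (fun y' => f x y' z) (pdy f x y z) y :=
  hf.pdy_eq x y z ▸ hf.hasDerivAt_y_fderiv x y z

theorem hasDerivAt_z (hf : SmoothXYZ f) (x y z : ℝ) :
    HasDerivAt (fun z' => f x y z') (pdz f x y z) z :=
  hf.pdz_eq x y z ▸ hf.hasDerivAt_z_fderiv x y z

theorem contDiff_fderiv_apply (hf : SmoothXYZ f) (v : ℝ × ℝ × ℝ) :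
    ContDiff ℝ (⊤ : ℕ∞) (fun p : ℝ × ℝ × ℝ =>
      fderiv ℝ (fun p : ℝ × ℝ × ℝ => f p.1 p.2.1 p.2.2) p v) :=
  (ContDiff.fderiv_right (m := (⊤ : ℕ∞)) hf (by simp)).clm_apply contDiff_const

theorem pdx (hf : SmoothXYZ f) : SmoothXYZ (pdx f) := by
  unfold SmoothXYZ
  simp only [hf.pdx_eq]
  exact hf.contDiff_fderiv_apply _

theorem pdy (hf : SmoothXYZ f) : SmoothXYZ (pdy f) := by
  unfold SmoothXYZ
  simp only [hf.pdy_eq]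
  exact hf.contDiff_fderiv_apply _

theorem pdz (hf : SmoothXYZ f) : SmoothXYZ (pdz f) := by
  unfold SmoothXYZ
  simp only [hf.pdz_eq]
  exact hf.contDiff_fderiv_apply _

theorem fderiv_fderiv_apply_comm (hf : SmoothXYZ f) (v w p : ℝ × ℝ × ℝ) :
    fderiv ℝ (fun q => fderiv ℝ (fun p : ℝ × ℝ × ℝ => f p.1 p.2.1 p.2.2) q v) p w =
      fderiv ℝ (fun q => fderiv ℝ (fun p : ℝ × ℝ × ℝ => f p.1 p.2.1 p.2.2) q w) p v := by
  have hd : DifferentiableAt ℝ (fderiv ℝ (fun p : ℝ × ℝ × ℝ => f p.1 p.2.1 p.2.2)) p :=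
    (ContDiff.fderiv_right (m := 1) hf one_add_one_le_infty).differentiable (by simp) p
  have key : ∀ v w : ℝ × ℝ × ℝ,
      fderiv ℝ (fun q => fderiv ℝ (fun p : ℝ × ℝ × ℝ => f p.1 p.2.1 p.2.2) q v) p w =
      fderiv ℝ (fderiv ℝ (fun p : ℝ × ℝ × ℝ => f p.1 p.2.1 p.2.2)) p w v := by
    intro v w
    rw [fderiv_clm_apply hd (differentiableAt_const v)]
    simp
  rw [key, key]
  have hsymm := (ContDiff.contDiffAt hf (x := p)).isSymmSndFDerivAt (by
    rw [minSmoothness_of_isRCLikeNormedField, ← one_add_one_eq_two]; exact one_add_one_le_infty)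
  exact hsymm w v

theorem pdx_pdy (hf : SmoothXYZ f) : _root_.pdx (_root_.pdy f) = _root_.pdy (_root_.pdx f) := by
  funext x y z
  rw [hf.pdy.pdx_eq, hf.pdx.pdy_eq]
  simp only [hf.pdx_eq, hf.pdy_eq]
  exact hf.fderiv_fderiv_apply_comm _ _ _

theorem pdx_pdz (hf : SmoothXYZ f) : _root_.pdx (_root_.pdz f) = _root_.pdz (_root_.pdx f) := by
  funext x y z
  rw [hf.pdz.pdx_eq, hf.pdx.pdz_eq]
  simp only [hf.pdx_eq, hf.pdz_eq]
  exact hf.fderiv_fderiv_apply_comm _ _ _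

theorem pdy_pdz (hf : SmoothXYZ f) : _root_.pdy (_root_.pdz f) = _root_.pdz (_root_.pdy f) := by
  funext x y z
  rw [hf.pdz.pdy_eq, hf.pdy.pdz_eq]
  simp only [hf.pdy_eq, hf.pdz_eq]
  exact hf.fderiv_fderiv_apply_comm _ _ _

theorem pdx_iterate (hf : SmoothXYZ f) (a : ℕ) : SmoothXYZ (_root_.pdx^[a] f) := by
  induction a with
  | zero => exact hf
  | succ a ih => rw [Function.iterate_succ_apply']; exact ih.pdx

theorem pdy_iterate (hf : SmoothXYZ f) (b : ℕ) : SmoothXYZ (_root_.pdy^[b] f) := by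
  induction b with
  | zero => exact hf
  | succ b ih => rw [Function.iterate_succ_apply']; exact ih.pdy

theorem pdh (hf : SmoothXYZ f) (a b : ℕ) : SmoothXYZ (pdh a b f) :=
  (hf.pdy_iterate b).pdx_iterate a

end SmoothXYZ

theorem pdx_pdh (a b : ℕ) (f : ℝ → ℝ → ℝ → ℝ) : pdx (pdh a b f) = pdh (a + 1) b f :=
  (Function.iterate_succ_apply' pdx a _).symm

theorem SmoothXYZ.pdy_pdh {f : ℝ → ℝ → ℝ → ℝ} (hf : SmoothXYZ f) (a b : ℕ) :
    _root_.pdy (_root_.pdh a b f) = _root_.pdh a (b + 1) f := by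
  induction a with
  | zero => exact (Function.iterate_succ_apply' _root_.pdy b f).symm
  | succ a ih => rw [← pdx_pdh, ← pdx_pdh, ← (hf.pdh a b).pdx_pdy, ih]

theorem SmoothXYZ.pdz_pdh {f : ℝ → ℝ → ℝ → ℝ} (hf : SmoothXYZ f) (a b : ℕ) :
    _root_.pdz (_root_.pdh a b f) = _root_.pdh a b (_root_.pdz f) := by
  induction a with
  | zero =>
    induction b with
    | zero => rfl
    | succ b ih => rw [← hf.pdy_pdh, ← hf.pdz.pdy_pdh, ← (hf.pdh 0 b).pdy_pdz, ih]
  | succ a ih => rw [← pdx_pdh, ← pdx_pdh, ← (hf.pdh a b).pdx_pdz, ih]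
/-- The operator `h ↦ h - z φ[h] / (2⟨t⟩)`, so that `u^r = radialVel t g`. -/
def radialVel (t : ℝ) (h : ℝ → ℝ → ℝ → ℝ) : ℝ → ℝ → ℝ → ℝ := fun x y z =>
  h x y z - z / (2 * angT t) * phiF t h x y z

theorem hasDerivAt_intervalIntegral_of_continuous {F F' : ℝ → ℝ → ℝ} (a b x₀ : ℝ)
    (hF : ∀ x, Continuous (F x)) (hF' : Continuous (Function.uncurry F'))
    (hd : ∀ x s, HasDerivAt (fun x' => F x' s) (F' x s) x) :
    HasDerivAt (fun x => ∫ s in a..b, F x s) (∫ s in a..b, F' x₀ s) x₀ := by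
  obtain ⟨M, hM⟩ := ((isCompact_closedBall x₀ 1).prod (isCompact_uIcc (a := a) (b := b))).exists_bound_of_continuousOn
    hF'.continuousOn
  refine (intervalIntegral.hasDerivAt_integral_of_dominated_loc_of_deriv_le
    (F := F) (F' := F') (bound := fun _ => M) (Metric.closedBall_mem_nhds x₀ one_pos)
    (Eventually.of_forall fun x => (hF x).aestronglyMeasurable)
    ((hF x₀).intervalIntegrable a b) ?_ ?_ intervalIntegrable_const ?_).2
  · exact (hF'.comp (Continuous.prodMk_right x₀)).aestronglyMeasurable
  · exact ae_of_all _ fun s hs x hx => hM (x, s) ⟨hx, uIoc_subset_uIcc hs⟩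
  · exact ae_of_all _ fun s _ x _ => hd x s

section radialVel

variable {h : ℝ → ℝ → ℝ → ℝ}

theorem SmoothXYZ.continuous_slice (hh : SmoothXYZ h) (x y : ℝ) : Continuous (h x y) :=
  hh.continuous.comp (by fun_prop : Continuous fun z : ℝ => ((x, y, z) : ℝ × ℝ × ℝ))

theorem SmoothXYZ.hasDerivAt_phiF_x (hh : SmoothXYZ h) (t x y z : ℝ) :
    HasDerivAt (fun x' => phiF t h x' y z) (phiF t (_root_.pdx h) x y z) x := by
  refine HasDerivAt.const_mul _ (hasDerivAt_intervalIntegral_of_continuous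
    (F := fun x s => h x y s * Real.exp (s ^ 2 / (4 * angT t)))
    (F' := fun x s => _root_.pdx h x y s * Real.exp (s ^ 2 / (4 * angT t))) _ _ _
    (fun x => ?_) ?_ fun x s => (hh.hasDerivAt_x x y s).mul_const _)
  · have := hh.continuous_slice x y
    fun_prop
  · have := hh.pdx.continuous.comp
      (by fun_prop : Continuous fun p : ℝ × ℝ => ((p.1, y, p.2) : ℝ × ℝ × ℝ))
    exact this.mul (by fun_prop)

theorem SmoothXYZ.hasDerivAt_phiF_y (hh : SmoothXYZ h) (t x y z : ℝ) :
    HasDerivAt (fun y' => phiF t h x y' z) (phiF t (_root_.pdy h) x y z) y := by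
  refine HasDerivAt.const_mul _ (hasDerivAt_intervalIntegral_of_continuous
    (F := fun y s => h x y s * Real.exp (s ^ 2 / (4 * angT t)))
    (F' := fun y s => _root_.pdy h x y s * Real.exp (s ^ 2 / (4 * angT t))) _ _ _
    (fun y => ?_) ?_ fun y s => (hh.hasDerivAt_y x y s).mul_const _)
  · have := hh.continuous_slice x y
    fun_prop
  · have := hh.pdy.continuous.comp
      (by fun_prop : Continuous fun p : ℝ × ℝ => ((x, p.1, p.2) : ℝ × ℝ × ℝ))
    exact this.mul (by fun_prop)

theorem SmoothXYZ.hasDerivAt_radialVel_x (hh : SmoothXYZ h) (t x y z : ℝ) :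
    HasDerivAt (fun x' => radialVel t h x' y z) (radialVel t (_root_.pdx h) x y z) x :=
  (hh.hasDerivAt_x x y z).sub ((hh.hasDerivAt_phiF_x t x y z).const_mul _)

theorem SmoothXYZ.hasDerivAt_radialVel_y (hh : SmoothXYZ h) (t x y z : ℝ) :
    HasDerivAt (fun y' => radialVel t h x y' z) (radialVel t (_root_.pdy h) x y z) y :=
  (hh.hasDerivAt_y x y z).sub ((hh.hasDerivAt_phiF_y t x y z).const_mul _)

theorem SmoothXYZ.continuous_radialVel (hh : SmoothXYZ h) (t : ℝ) :
    Continuous (fun p : ℝ × ℝ × ℝ => radialVel t h p.1 p.2.1 p.2.2) := by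
  have h_int : Continuous fun p : ℝ × ℝ × ℝ =>
      ∫ s in (0 : ℝ)..p.2.2, h p.1 p.2.1 s * Real.exp (s ^ 2 / (4 * angT t)) := by
    refine intervalIntegral.continuous_parametric_intervalIntegral_of_continuous
      (f := fun (p : ℝ × ℝ × ℝ) s => h p.1 p.2.1 s * Real.exp (s ^ 2 / (4 * angT t))) ?_
      (by fun_prop)
    have := hh.continuous.comp (by fun_prop : Continuous fun q : (ℝ × ℝ × ℝ) × ℝ =>
      ((q.1.1, q.1.2.1, q.2) : ℝ × ℝ × ℝ))
    exact this.mul (by fun_prop)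
  have := hh.continuous
  unfold radialVel phiF
  fun_prop

theorem SmoothXYZ.ur_eq (hh : SmoothXYZ h) {t : ℝ} (ht : 0 ≤ t) : ur t h = radialVel t h := by
  funext x y z
  have hT : angT t ≠ 0 := by unfold angT; positivity
  have hcont : Continuous fun s => h x y s * Real.exp (s ^ 2 / (4 * angT t)) := by
    have := hh.continuous_slice x y
    fun_prop
  have h1 := intervalIntegral.integral_hasDerivAt_right (hcont.intervalIntegrable 0 z)
    (hcont.stronglyMeasurableAtFilter _ _) hcont.continuousAt
  have h2 : HasDerivAt (fun z : ℝ => Real.exp (-(z ^ 2) / (4 * angT t)))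
      (Real.exp (-(z ^ 2) / (4 * angT t)) * (-(2 * z) / (4 * angT t))) z := by
    have := (((hasDerivAt_pow 2 z).neg).div_const (4 * angT t)).exp
    simpa using this
  have h3 := (h2.mul h1).deriv
  have h4 : Real.exp (-(z ^ 2) / (4 * angT t)) * Real.exp (z ^ 2 / (4 * angT t)) = 1 := by
    rw [← Real.exp_add, neg_div, neg_add_cancel, Real.exp_zero]
  refine h3.trans ?_
  unfold radialVel phiF
  rw [mul_left_comm, h4]
  field_simp
  ring

end radialVel

section Leibniz

theorem hasDerivAt_leibniz_sum {u v : ℕ → ℝ → ℝ} {s : ℝ}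
    (hu : ∀ i, HasDerivAt (u i) (u (i + 1) s) s) (hv : ∀ i, HasDerivAt (v i) (v (i + 1) s) s)
    (n : ℕ) :
    HasDerivAt (fun s => ∑ q ∈ Finset.HasAntidiagonal.antidiagonal n, (n.choose q.1 : ℝ) * (u q.1 s * v q.2 s))
      (∑ q ∈ Finset.HasAntidiagonal.antidiagonal (n + 1), ((n + 1).choose q.1 : ℝ) * (u q.1 s * v q.2 s)) s := by
  rw [Finset.sum_antidiagonal_choose_succ_mul (fun i j => u i s * v j s) n,
    ← Finset.sum_add_distrib]
  refine HasDerivAt.fun_sum fun q hq => ?_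
  rw [Nat.choose_symm_of_eq_add (Finset.HasAntidiagonal.mem_antidiagonal.1 hq).symm, ← mul_add]
  refine (((hu q.1).mul (hv q.2)).const_mul _).congr_deriv ?_
  ring

theorem pdh_mul {U V : ℕ → ℕ → ℝ → ℝ → ℝ → ℝ}
    (hUx : ∀ i j x y z, HasDerivAt (fun x' => U i j x' y z) (U (i + 1) j x y z) x)
    (hUy : ∀ i j x y z, HasDerivAt (fun y' => U i j x y' z) (U i (j + 1) x y z) y)
    (hVx : ∀ i j x y z, HasDerivAt (fun x' => V i j x' y z) (V (i + 1) j x y z) x)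
    (hVy : ∀ i j x y z, HasDerivAt (fun y' => V i j x y' z) (V i (j + 1) x y z) y)
    (a b : ℕ) (x y z : ℝ) :
    pdh a b (fun x y z => U 0 0 x y z * V 0 0 x y z) x y z =
      ∑ p ∈ Finset.HasAntidiagonal.antidiagonal a, ∑ q ∈ Finset.HasAntidiagonal.antidiagonal b,
        (a.choose p.1 : ℝ) * (b.choose q.1 : ℝ) * (U p.1 q.1 x y z * V p.2 q.2 x y z) := by
  have hb : ∀ b, pdy^[b] (fun x y z => U 0 0 x y z * V 0 0 x y z) = fun x y z =>
      ∑ q ∈ Finset.HasAntidiagonal.antidiagonal b, (b.choose q.1 : ℝ) * (U 0 q.1 x y z * V 0 q.2 x y z) := by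
    intro b
    induction b with
    | zero => funext x y z; simp
    | succ b ih =>
      rw [Function.iterate_succ_apply', ih]
      funext x y z
      exact (hasDerivAt_leibniz_sum (u := fun j y => U 0 j x y z) (v := fun j y => V 0 j x y z)
        (fun j => hUy 0 j x y z) (fun j => hVy 0 j x y z) b).deriv
  have ha : ∀ a, pdh a b (fun x y z => U 0 0 x y z * V 0 0 x y z) = fun x y z =>
      ∑ q ∈ Finset.HasAntidiagonal.antidiagonal b, (b.choose q.1 : ℝ) * ∑ p ∈ Finset.HasAntidiagonal.antidiagonal a,
        (a.choose p.1 : ℝ) * (U p.1 q.1 x y z * V p.2 q.2 x y z) := by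
    intro a
    induction a with
    | zero => unfold pdh; funext x y z; simp [hb]
    | succ a ih =>
      rw [← pdx_pdh, ih]
      funext x y z
      refine (HasDerivAt.fun_sum fun q _ => HasDerivAt.const_mul _ ?_).deriv
      exact hasDerivAt_leibniz_sum (u := fun i x => U i q.1 x y z) (v := fun i x => V i q.2 x y z)
        (fun i => hUx i q.1 x y z) (fun i => hVx i q.2 x y z) a
  rw [ha]
  simp only [Finset.mul_sum]
  rw [Finset.sum_comm]
  exact Finset.sum_congr rfl fun p _ => Finset.sum_congr rfl fun q _ => by ring

end Leibniz

/-- The value of `∂^α_h (r∂_r g)` for `α = (a, b)`. -/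
def rdrDeriv (g : ℝ → ℝ → ℝ → ℝ) (a b : ℕ) : ℝ → ℝ → ℝ → ℝ := fun x y z =>
  x * pdh (a + 1) b g x y z + y * pdh a (b + 1) g x y z + ((a + b : ℕ) : ℝ) * pdh a b g x y z

section rdr

variable {g : ℝ → ℝ → ℝ → ℝ}

theorem rdrDeriv_zero_zero : rdrDeriv g 0 0 = rdr g := by
  funext x y z
  simp [rdrDeriv, rdr, pdh]

theorem SmoothXYZ.hasDerivAt_pdh_x (hg : SmoothXYZ g) (a b : ℕ) (x y z : ℝ) :
    HasDerivAt (fun x' => _root_.pdh a b g x' y z) (_root_.pdh (a + 1) b g x y z) x :=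
  pdx_pdh a b g ▸ (hg.pdh a b).hasDerivAt_x x y z

theorem SmoothXYZ.hasDerivAt_pdh_y (hg : SmoothXYZ g) (a b : ℕ) (x y z : ℝ) :
    HasDerivAt (fun y' => _root_.pdh a b g x y' z) (_root_.pdh a (b + 1) g x y z) y :=
  hg.pdy_pdh a b ▸ (hg.pdh a b).hasDerivAt_y x y z

theorem SmoothXYZ.pdh_ur_mul_rdr (hg : SmoothXYZ g) {t : ℝ} (ht : 0 ≤ t) (a b : ℕ) (x y z : ℝ) :
    _root_.pdh a b (fun x' y' z' => ur t g x' y' z' * rdr g x' y' z') x y z =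
      ∑ p ∈ Finset.HasAntidiagonal.antidiagonal a, ∑ q ∈ Finset.HasAntidiagonal.antidiagonal b,
        (a.choose p.1 : ℝ) * (b.choose q.1 : ℝ) *
          (radialVel t (_root_.pdh p.1 q.1 g) x y z * rdrDeriv g p.2 q.2 x y z) := by
  rw [hg.ur_eq ht, ← rdrDeriv_zero_zero]
  refine pdh_mul (U := fun i j => radialVel t (_root_.pdh i j g)) (V := rdrDeriv g)
    ?_ ?_ ?_ ?_ a b x y z
  · intro i j x y z
    exact pdx_pdh i j g ▸ (hg.pdh i j).hasDerivAt_radialVel_x t x y z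
  · intro i j x y z
    exact hg.pdy_pdh i j ▸ (hg.pdh i j).hasDerivAt_radialVel_y t x y z
  · intro i j x y z
    refine ((((hasDerivAt_id x).mul (hg.hasDerivAt_pdh_x (i + 1) j x y z)).add
      ((hg.hasDerivAt_pdh_x i (j + 1) x y z).const_mul y)).add
      ((hg.hasDerivAt_pdh_x i j x y z).const_mul ((i + j : ℕ) : ℝ))).congr_deriv ?_
    simp only [rdrDeriv, id]
    push_cast
    ring
  · intro i j x y z
    refine ((((hg.hasDerivAt_pdh_y (i + 1) j x y z).const_mul x).add
      ((hasDerivAt_id y).mul (hg.hasDerivAt_pdh_y i (j + 1) x y z))).add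
      ((hg.hasDerivAt_pdh_y i j x y z).const_mul ((i + j : ℕ) : ℝ))).congr_deriv ?_
    simp only [rdrDeriv, id]
    push_cast
    ring

end rdr

open scoped ENNReal

theorem sq_le_add_integral_sq_of_hasDerivAt {f f' : ℝ → ℝ} (hf : ∀ s, HasDerivAt f (f' s) s)
    (hf' : Continuous f') {a x s : ℝ} (hx : x ∈ Icc a (a + 1)) (hs : s ∈ Icc a (a + 1)) :
    f x ^ 2 ≤ f s ^ 2 + ∫ u in Icc a (a + 1), (f u ^ 2 + f' u ^ 2) := by
  have hfc : Continuous f := continuous_iff_continuousAt.2 fun s => (hf s).continuousAt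
  have h1 : ∫ u in s..x, 2 * f u * f' u = f x ^ 2 - f s ^ 2 :=
    intervalIntegral.integral_eq_sub_of_hasDerivAt (f := fun u => f u ^ 2)
      (fun u _ => by simpa using (hf u).fun_pow 2)
      ((by fun_prop : Continuous fun u => 2 * f u * f' u).intervalIntegrable _ _)
  have h2 : ∫ u in s..x, 2 * f u * f' u ≤ ∫ u in Icc a (a + 1), (f u ^ 2 + f' u ^ 2) := by
    refine (Real.le_norm_self _).trans
      ((intervalIntegral.norm_integral_le_integral_norm_uIoc).trans ?_)
    refine le_trans (setIntegral_mono_on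
      (by fun_prop : Continuous fun u => ‖2 * f u * f' u‖).integrableOn_uIoc
      (by fun_prop : Continuous fun u => f u ^ 2 + f' u ^ 2).integrableOn_uIoc
      measurableSet_uIoc fun u _ => ?_) (setIntegral_mono_set
      (by fun_prop : Continuous fun u => f u ^ 2 + f' u ^ 2).integrableOn_Icc
      (ae_of_all _ fun u => by positivity)
      (LE.le.eventuallyLE (uIoc_subset_uIcc.trans (uIcc_subset_Icc hs hx))))
    rw [Real.norm_eq_abs, abs_le]
    constructor <;> nlinarith [sq_nonneg (f u + f' u), sq_nonneg (f u - f' u)]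
  linarith

theorem ofReal_sq_le_lintegral_Icc {f f' : ℝ → ℝ} (hf : ∀ s, HasDerivAt f (f' s) s)
    (hf' : Continuous f') {a x : ℝ} (hx : x ∈ Icc a (a + 1)) :
    ENNReal.ofReal (f x ^ 2) ≤
      2 * ∫⁻ s in Icc a (a + 1), (ENNReal.ofReal (f s ^ 2) + ENNReal.ofReal (f' s ^ 2)) := by
  have hfc : Continuous f := continuous_iff_continuousAt.2 fun s => (hf s).continuousAt
  set K := ∫ u in Icc a (a + 1), (f u ^ 2 + f' u ^ 2) with hK
  have h1 : IntegrableOn (fun u => f u ^ 2) (Icc a (a + 1)) :=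
    (by fun_prop : Continuous fun u => f u ^ 2).integrableOn_Icc
  have h2 : IntegrableOn (fun u => f u ^ 2 + f' u ^ 2) (Icc a (a + 1)) :=
    (by fun_prop : Continuous fun u => f u ^ 2 + f' u ^ 2).integrableOn_Icc
  have hone : volume.real (Icc a (a + 1)) = 1 := by simp
  have hfin : volume (Icc a (a + 1)) ≠ ∞ := by simp
  have hx2 : f x ^ 2 ≤ 2 * K := by
    have h3 : ∫ _ in Icc a (a + 1), f x ^ 2 ≤ ∫ s in Icc a (a + 1), (f s ^ 2 + K) :=
      setIntegral_mono_on (integrableOn_const hfin) (h1.add (integrableOn_const hfin))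
        measurableSet_Icc fun s hs => sq_le_add_integral_sq_of_hasDerivAt hf hf' hx hs
    rw [integral_add h1 (integrableOn_const hfin), setIntegral_const, setIntegral_const, hone,
      one_smul, one_smul] at h3
    have h4 : ∫ s in Icc a (a + 1), f s ^ 2 ≤ K :=
      setIntegral_mono_on h1 h2 measurableSet_Icc fun s _ => by nlinarith [sq_nonneg (f' s)]
    linarith
  calc ENNReal.ofReal (f x ^ 2) ≤ ENNReal.ofReal (2 * K) := ENNReal.ofReal_le_ofReal hx2
    _ = 2 * ENNReal.ofReal K := by rw [ENNReal.ofReal_mul (by norm_num), ENNReal.ofReal_ofNat]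
    _ = _ := by
      rw [hK, ofReal_integral_eq_lintegral_ofReal h2 (ae_of_all _ fun u => by positivity)]
      congr 1
      exact lintegral_congr fun s => ENNReal.ofReal_add (sq_nonneg _) (sq_nonneg _)

theorem ofReal_weighted_sq_le_lintegral_Icc {f f' w w' : ℝ → ℝ} {c : ℝ} (hc : 0 ≤ c)
    (hf : ∀ s, HasDerivAt f (f' s) s)
    (hf' : Continuous f') {a x : ℝ} (hx : x ∈ Icc a (a + 1))
    (hw : ∀ s ∈ Icc a (a + 1), c ≤ w s) (hw' : ∀ s ∈ Icc a (a + 1), c ≤ w' s) :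
    ENNReal.ofReal ((c * f x) ^ 2) ≤ 2 * ∫⁻ s in Icc a (a + 1),
      (ENNReal.ofReal ((w s * f s) ^ 2) + ENNReal.ofReal ((w' s * f' s) ^ 2)) := by
  rw [mul_pow, ENNReal.ofReal_mul (sq_nonneg c)]
  refine (mul_le_mul_right (ofReal_sq_le_lintegral_Icc hf hf' hx) _).trans ?_
  rw [mul_left_comm, ← lintegral_const_mul' _ _ ENNReal.ofReal_ne_top]
  refine mul_le_mul_right (setLIntegral_mono' measurableSet_Icc fun s hs => ?_) _
  rw [mul_add, ← ENNReal.ofReal_mul (sq_nonneg c), ← ENNReal.ofReal_mul (sq_nonneg c)]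
  gcongr
  · rw [mul_pow]
    gcongr
    exact hw s hs
  · rw [mul_pow]
    gcongr
    exact hw' s hs

theorem ofReal_weighted_sq_le_lintegral {f f' w w' : ℝ → ℝ} (hf : ∀ s, HasDerivAt f (f' s) s)
    (hf' : Continuous f') (x : ℝ) (hwx : 0 ≤ w x)
    (hw : ∀ s, |x| ≤ |s| → w x ≤ w s) (hw' : ∀ s, |x| ≤ |s| → w x ≤ w' s) :
    ENNReal.ofReal ((w x * f x) ^ 2) ≤ 2 * ∫⁻ s,
      (ENNReal.ofReal ((w s * f s) ^ 2) + ENNReal.ofReal ((w' s * f' s) ^ 2)) := by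
  obtain ⟨a, ha, hs⟩ : ∃ a, x ∈ Icc a (a + 1) ∧ ∀ s ∈ Icc a (a + 1), |x| ≤ |s| := by
    rcases le_total 0 x with h | h
    · refine ⟨x, ⟨le_rfl, by linarith⟩, fun s hs => ?_⟩
      rw [abs_of_nonneg h, abs_of_nonneg (h.trans hs.1)]
      exact hs.1
    · refine ⟨x - 1, ⟨by linarith, by linarith⟩, fun s hs => ?_⟩
      have : s ≤ x := by linarith [hs.2]
      rw [abs_of_nonpos h, abs_of_nonpos (this.trans h)]
      linarith
  refine (ofReal_weighted_sq_le_lintegral_Icc hwx hf hf' ha (fun s h => hw s (hs s h))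
    (fun s h => hw' s (hs s h))).trans ?_
  exact mul_le_mul_right (setLIntegral_le_lintegral _ _) _

theorem sq_integral_le_mul_integral_sq {k : ℝ → ℝ} (hk : Continuous k) {z : ℝ} (hz : 0 < z) :
    (∫ s in (0 : ℝ)..z, k s) ^ 2 ≤ z * ∫ s in (0 : ℝ)..z, k s ^ 2 := by
  set A := ∫ s in (0 : ℝ)..z, k s with hA
  have h0 : 0 ≤ ∫ s in (0 : ℝ)..z, (k s ^ 2 - 2 * (A / z) * k s + (A / z) ^ 2) := by
    refine intervalIntegral.integral_nonneg hz.le fun s _ => ?_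
    nlinarith [sq_nonneg (k s - A / z)]
  rw [intervalIntegral.integral_add, intervalIntegral.integral_sub,
    intervalIntegral.integral_const_mul, intervalIntegral.integral_const, ← hA, smul_eq_mul,
    sub_zero] at h0
  · have h1 : z * (A / z) = A := by field_simp
    nlinarith
  all_goals exact Continuous.intervalIntegrable (by fun_prop) _ _

section weights

theorem one_le_angT {t : ℝ} (ht : 0 ≤ t) : 1 ≤ angT t := by unfold angT; linarith

theorem angR_pos (x y : ℝ) : 0 < angR x y := by unfold angR; positivity

theorem one_le_angR (x y : ℝ) : 1 ≤ angR x y := by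
  unfold angR
  rw [Real.one_le_sqrt]
  nlinarith [sq_nonneg x, sq_nonneg y]

theorem abs_fst_le_angR (x y : ℝ) : |x| ≤ angR x y :=
  Real.abs_le_sqrt (by nlinarith [sq_nonneg y])

theorem abs_snd_le_angR (x y : ℝ) : |y| ≤ angR x y :=
  Real.abs_le_sqrt (by nlinarith [sq_nonneg x])

theorem angR_le_angR {x x' y y' : ℝ} (hx : |x| ≤ |x'|) (hy : |y| ≤ |y'|) :
    angR x y ≤ angR x' y' := by
  have h1 := sq_le_sq.2 hx
  have h2 := sq_le_sq.2 hy
  exact Real.sqrt_le_sqrt (by linarith)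

theorem thw_pos (t l z : ℝ) : 0 < thw t l z := Real.exp_pos _

theorem thw_two (t z : ℝ) : thw t 2 z = thw t 1 z ^ 2 := by
  unfold thw
  rw [← Real.exp_nat_mul]
  congr 1
  push_cast
  ring

theorem one_le_thw {t : ℝ} (ht : 0 ≤ t) (z : ℝ) : 1 ≤ thw t 1 z := by
  have := one_le_angT ht
  exact Real.one_le_exp (by positivity)

theorem continuous_angR : Continuous fun p : ℝ × ℝ × ℝ => angR p.1 p.2.1 := by
  unfold angR
  fun_prop

theorem continuous_thw (t l : ℝ) : Continuous (thw t l) := by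
  unfold thw
  fun_prop

end weights

/-- The density `(θ ⟨r⟩ⁿ h)²`, as an extended nonnegative real. -/
def wsq (t : ℝ) (n : ℕ) (h : ℝ → ℝ → ℝ → ℝ) (x y z : ℝ) : ℝ≥0∞ :=
  ENNReal.ofReal ((thw t 1 z * angR x y ^ n * h x y z) ^ 2)

/-- The integral of `(θ ⟨r⟩ⁿ h)²` over the vertical half-line above `(x, y)`. -/
def vertEnergy (t : ℝ) (n : ℕ) (h : ℝ → ℝ → ℝ → ℝ) (x y : ℝ) : ℝ≥0∞ :=
  ∫⁻ z in Ioi (0 : ℝ), wsq t n h x y z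

/-- The integral of `(θ ⟨r⟩ⁿ h)²` over `ℝ² × (0,∞)`. -/
def energy (t : ℝ) (n : ℕ) (h : ℝ → ℝ → ℝ → ℝ) : ℝ≥0∞ :=
  ∫⁻ x, ∫⁻ y, vertEnergy t n h x y

section energies

variable {h : ℝ → ℝ → ℝ → ℝ}

theorem measurable_wsq (t : ℝ) (n : ℕ)
    (hh : Continuous fun p : ℝ × ℝ × ℝ => h p.1 p.2.1 p.2.2) :
    Measurable fun p : ℝ × ℝ × ℝ => wsq t n h p.1 p.2.1 p.2.2 := by
  have h1 := continuous_angR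
  have h2 := (continuous_thw t 1).comp (by fun_prop : Continuous fun p : ℝ × ℝ × ℝ => p.2.2)
  exact (((h2.mul (h1.pow n)).mul hh).pow 2).measurable.ennreal_ofReal

theorem measurable_wsq_comp (t : ℝ) (n : ℕ)
    (hh : Continuous fun p : ℝ × ℝ × ℝ => h p.1 p.2.1 p.2.2) {α : Type*} [MeasurableSpace α]
    {X Y Z : α → ℝ} (hX : Measurable X) (hY : Measurable Y) (hZ : Measurable Z) :
    Measurable fun a => wsq t n h (X a) (Y a) (Z a) :=
  Measurable.comp (g := fun p : ℝ × ℝ × ℝ => wsq t n h p.1 p.2.1 p.2.2)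
    (f := fun a => (X a, Y a, Z a)) (measurable_wsq t n hh) (hX.prodMk (hY.prodMk hZ))

theorem measurable_vertEnergy (t : ℝ) (n : ℕ)
    (hh : Continuous fun p : ℝ × ℝ × ℝ => h p.1 p.2.1 p.2.2) :
    Measurable fun p : ℝ × ℝ => vertEnergy t n h p.1 p.2 :=
  Measurable.lintegral_prod_right' (f := fun q : (ℝ × ℝ) × ℝ => wsq t n h q.1.1 q.1.2 q.2)
    (measurable_wsq_comp t n hh (by fun_prop) (by fun_prop) (by fun_prop))

theorem measurable_vertEnergy_comp (t : ℝ) (n : ℕ)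
    (hh : Continuous fun p : ℝ × ℝ × ℝ => h p.1 p.2.1 p.2.2) {α : Type*} [MeasurableSpace α]
    {X Y : α → ℝ} (hX : Measurable X) (hY : Measurable Y) :
    Measurable fun a => vertEnergy t n h (X a) (Y a) :=
  Measurable.comp (g := fun p : ℝ × ℝ => vertEnergy t n h p.1 p.2)
    (f := fun a => (X a, Y a)) (measurable_vertEnergy t n hh) (hX.prodMk hY)

theorem measurable_lintegral_vertEnergy (t : ℝ) (n : ℕ)
    (hh : Continuous fun p : ℝ × ℝ × ℝ => h p.1 p.2.1 p.2.2) :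
    Measurable fun x : ℝ => ∫⁻ y, vertEnergy t n h x y :=
  (measurable_vertEnergy t n hh).lintegral_prod_right'

theorem vertEnergy_le_lintegral_x (hh : SmoothXYZ h) (t : ℝ) (n : ℕ) (x y : ℝ) :
    vertEnergy t n h x y ≤
      2 * ∫⁻ x', (vertEnergy t n h x' y + vertEnergy t (n + 1) (pdx h) x' y) := by
  have hm : ∀ (n : ℕ) {k : ℝ → ℝ → ℝ → ℝ}, SmoothXYZ k →
      Measurable fun q : ℝ × ℝ => wsq t n k q.2 y q.1 := fun n k hk =>
    measurable_wsq_comp t n hk.continuous (by fun_prop) (by fun_prop) (by fun_prop)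
  calc vertEnergy t n h x y
      ≤ ∫⁻ z in Ioi (0 : ℝ), 2 * ∫⁻ x', (wsq t n h x' y z + wsq t (n + 1) (pdx h) x' y z) := by
        refine lintegral_mono fun z => ?_
        refine ofReal_weighted_sq_le_lintegral (f := fun x => h x y z)
          (f' := fun x => pdx h x y z) (w := fun x => thw t 1 z * angR x y ^ n)
          (w' := fun x => thw t 1 z * angR x y ^ (n + 1)) (fun s => hh.hasDerivAt_x s y z)
          (hh.pdx.continuous.comp (by fun_prop : Continuous fun s : ℝ => ((s, y, z) : ℝ × ℝ × ℝ)))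
          x (mul_nonneg (thw_pos _ _ _).le (pow_nonneg (angR_pos _ _).le _)) ?_ ?_
        · intro s hs
          exact mul_le_mul_of_nonneg_left (pow_le_pow_left₀ (angR_pos _ _).le
            (angR_le_angR hs le_rfl) _) (thw_pos _ _ _).le
        · intro s hs
          exact mul_le_mul_of_nonneg_left ((pow_le_pow_left₀ (angR_pos _ _).le
            (angR_le_angR hs le_rfl) _).trans
            (pow_le_pow_right₀ (one_le_angR _ _) (Nat.le_succ n))) (thw_pos _ _ _).le
    _ = 2 * ∫⁻ x', ∫⁻ z in Ioi (0 : ℝ), (wsq t n h x' y z + wsq t (n + 1) (pdx h) x' y z) := by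
        rw [lintegral_const_mul' _ _ (by norm_num), lintegral_lintegral_swap]
        exact ((hm n hh).add (hm (n + 1) hh.pdx)).aemeasurable
    _ = _ := by
        congr 1
        refine lintegral_congr fun x' => ?_
        exact lintegral_add_left (measurable_wsq_comp t n hh.continuous (by fun_prop) (by fun_prop)
          (by fun_prop)) _

theorem vertEnergy_le_lintegral_y (hh : SmoothXYZ h) (t : ℝ) (n : ℕ) (x y : ℝ) :
    vertEnergy t n h x y ≤
      2 * ∫⁻ y', (vertEnergy t n h x y' + vertEnergy t (n + 1) (pdy h) x y') := by
  have hm : ∀ (n : ℕ) {k : ℝ → ℝ → ℝ → ℝ}, SmoothXYZ k →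
      Measurable fun q : ℝ × ℝ => wsq t n k x q.2 q.1 := fun n k hk =>
    measurable_wsq_comp t n hk.continuous (by fun_prop) (by fun_prop) (by fun_prop)
  calc vertEnergy t n h x y
      ≤ ∫⁻ z in Ioi (0 : ℝ), 2 * ∫⁻ y', (wsq t n h x y' z + wsq t (n + 1) (pdy h) x y' z) := by
        refine lintegral_mono fun z => ?_
        refine ofReal_weighted_sq_le_lintegral (f := fun y => h x y z)
          (f' := fun y => pdy h x y z) (w := fun y => thw t 1 z * angR x y ^ n)
          (w' := fun y => thw t 1 z * angR x y ^ (n + 1)) (fun s => hh.hasDerivAt_y x s z)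
          (hh.pdy.continuous.comp (by fun_prop : Continuous fun s : ℝ => ((x, s, z) : ℝ × ℝ × ℝ)))
          y (mul_nonneg (thw_pos _ _ _).le (pow_nonneg (angR_pos _ _).le _)) ?_ ?_
        · intro s hs
          exact mul_le_mul_of_nonneg_left (pow_le_pow_left₀ (angR_pos _ _).le
            (angR_le_angR le_rfl hs) _) (thw_pos _ _ _).le
        · intro s hs
          exact mul_le_mul_of_nonneg_left ((pow_le_pow_left₀ (angR_pos _ _).le
            (angR_le_angR le_rfl hs) _).trans
            (pow_le_pow_right₀ (one_le_angR _ _) (Nat.le_succ n))) (thw_pos _ _ _).le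
    _ = 2 * ∫⁻ y', ∫⁻ z in Ioi (0 : ℝ), (wsq t n h x y' z + wsq t (n + 1) (pdy h) x y' z) := by
        rw [lintegral_const_mul' _ _ (by norm_num), lintegral_lintegral_swap]
        exact ((hm n hh).add (hm (n + 1) hh.pdy)).aemeasurable
    _ = _ := by
        congr 1
        refine lintegral_congr fun y' => ?_
        exact lintegral_add_left (measurable_wsq_comp t n hh.continuous (by fun_prop) (by fun_prop)
          (by fun_prop)) _

/-- Anisotropic Sobolev embedding `H² ⊂ L^∞` in the horizontal variables. -/
theorem vertEnergy_le_energy (hh : SmoothXYZ h) (t : ℝ) (n : ℕ) (x y : ℝ) :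
    vertEnergy t n h x y ≤ 4 * (energy t n h + energy t (n + 1) (pdy h) +
      (energy t (n + 1) (pdx h) + energy t (n + 2) (pdy (pdx h)))) := by
  have hslice : ∀ (n : ℕ) {k : ℝ → ℝ → ℝ → ℝ}, SmoothXYZ k → ∀ x,
      Measurable fun y => vertEnergy t n k x y := fun n k hk x =>
    measurable_vertEnergy_comp t n hk.continuous (by fun_prop) (by fun_prop)
  have key : ∀ (n : ℕ) {k : ℝ → ℝ → ℝ → ℝ}, SmoothXYZ k → ∀ x,
      vertEnergy t n k x y ≤
        2 * ((∫⁻ y', vertEnergy t n k x y') + ∫⁻ y', vertEnergy t (n + 1) (pdy k) x y') := by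
    intro n k hk x
    rw [← lintegral_add_left (hslice n hk x)]
    exact vertEnergy_le_lintegral_y hk t n x y
  refine (vertEnergy_le_lintegral_x hh t n x y).trans ?_
  calc 2 * ∫⁻ x', (vertEnergy t n h x' y + vertEnergy t (n + 1) (pdx h) x' y)
      ≤ 2 * ∫⁻ x', 2 * (((∫⁻ y', vertEnergy t n h x' y') +
            ∫⁻ y', vertEnergy t (n + 1) (pdy h) x' y') +
          ((∫⁻ y', vertEnergy t (n + 1) (pdx h) x' y') +
            ∫⁻ y', vertEnergy t (n + 2) (pdy (pdx h)) x' y')) := by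
        refine mul_le_mul_right (lintegral_mono fun x' => ?_) _
        rw [mul_add]
        exact add_le_add (key n hh x') (key (n + 1) hh.pdx x')
    _ = _ := by
        rw [lintegral_const_mul' _ _ (by norm_num), ← mul_assoc, lintegral_add_left,
          lintegral_add_left, lintegral_add_left]
        · simp only [energy]
          norm_num
        · exact measurable_lintegral_vertEnergy _ _ hh.pdx.continuous
        · exact measurable_lintegral_vertEnergy _ _ hh.continuous
        · exact (measurable_lintegral_vertEnergy _ _ hh.continuous).add
            (measurable_lintegral_vertEnergy _ _ hh.pdy.continuous)

theorem ofReal_sq_le_vertEnergy (hh : SmoothXYZ h) {t : ℝ} (ht : 0 ≤ t) (n : ℕ) (x y : ℝ)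
    {z : ℝ} (hz : 0 < z) :
    ENNReal.ofReal ((angR x y ^ n * h x y z) ^ 2) ≤
      2 * (vertEnergy t n h x y + vertEnergy t n (pdz h) x y) := by
  have hw : ∀ s ∈ Icc z (z + 1), angR x y ^ n ≤ thw t 1 s * angR x y ^ n := fun s _ =>
    le_mul_of_one_le_left (pow_nonneg (angR_pos _ _).le _) (one_le_thw ht s)
  refine (ofReal_weighted_sq_le_lintegral_Icc (f := h x y) (f' := pdz h x y)
    (pow_nonneg (angR_pos _ _).le _) (fun s => hh.hasDerivAt_z x y s)
    (hh.pdz.continuous_slice x y) (left_mem_Icc.2 (by linarith)) hw hw).trans ?_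
  refine mul_le_mul_right ?_ _
  have hm : Measurable fun s => wsq t n h x y s :=
    measurable_wsq_comp t n hh.continuous (by fun_prop) (by fun_prop) (by fun_prop)
  refine (lintegral_mono_set (μ := volume) (t := Ioi (0 : ℝ)) fun s hs => hz.trans_le hs.1).trans_eq
    (lintegral_add_left hm _)

theorem sq_phiF_term_le (hh : SmoothXYZ h) {t : ℝ} (ht : 0 ≤ t) (x y : ℝ) {z : ℝ} (hz : 0 < z) :
    (z / (2 * angT t) * phiF t h x y z) ^ 2 ≤
      9 / 2 * ∫ s in (0 : ℝ)..z, (thw t 1 s * h x y s) ^ 2 := by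
  have hT := one_le_angT ht
  have hTpos : 0 < angT t := by linarith
  have hhc := hh.continuous_slice x y
  have hthc := continuous_thw t 1
  set E := Real.exp (z ^ 2 / (4 * angT t)) with hE
  set J := ∫ s in (0 : ℝ)..z, (thw t 1 s * h x y s) ^ 2 with hJ
  have hJ0 : 0 ≤ J := intervalIntegral.integral_nonneg hz.le fun s _ => sq_nonneg _
  have hexp : ∀ s : ℝ, Real.exp (s ^ 2 / (4 * angT t)) = thw t 1 s ^ 2 := by
    intro s
    rw [← thw_two]
    unfold thw
    congr 1
    field_simp
    ring
  have h_int : (∫ s in (0 : ℝ)..z, h x y s * Real.exp (s ^ 2 / (4 * angT t))) ^ 2 ≤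
      z * (E * J) := by
    refine (sq_integral_le_mul_integral_sq (by fun_prop) hz).trans ?_
    refine mul_le_mul_of_nonneg_left ?_ hz.le
    rw [hJ, ← intervalIntegral.integral_const_mul]
    refine intervalIntegral.integral_mono_on hz.le
      ((by fun_prop : Continuous _).intervalIntegrable _ _)
      ((by fun_prop : Continuous _).intervalIntegrable _ _) fun s hs => ?_
    have h1 : Real.exp (s ^ 2 / (4 * angT t)) ≤ E := by
      have := pow_le_pow_left₀ hs.1 hs.2 2
      rw [hE]
      gcongr
    rw [mul_pow, sq (Real.exp _)]
    nth_rewrite 1 [hexp s]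
    have h2 := mul_le_mul_of_nonneg_left h1 (sq_nonneg (thw t 1 s * h x y s))
    nlinarith
  set q := z ^ 2 / (4 * angT t) with hq
  have hq0 : 0 ≤ q := by positivity
  have hEq1 : q ≤ E := by linarith [Real.add_one_le_exp q]
  have hEq2 : q ^ 2 ≤ 2 * E := by
    have := Real.quadratic_le_exp_of_nonneg hq0
    nlinarith
  have hcoef : z ^ 3 / (4 * angT t ^ 2) ≤ 9 / 2 * E := by
    have h1 : z ^ 3 ≤ (z ^ 2 + z ^ 4) / 2 := by nlinarith [mul_nonneg (sq_nonneg z) (sq_nonneg (z - 1))]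
    have h2 : z ^ 2 = 4 * angT t * q := by rw [hq]; field_simp
    have h3 : z ^ 4 = 16 * angT t ^ 2 * q ^ 2 := by
      rw [show z ^ 4 = (z ^ 2) ^ 2 by ring, h2]; ring
    rw [div_le_iff₀ (by positivity)]
    have h4 : angT t * q ≤ angT t ^ 2 * E := by
      have : angT t ≤ angT t ^ 2 := by nlinarith
      exact mul_le_mul this hEq1 hq0 (by positivity)
    have h5 : angT t ^ 2 * q ^ 2 ≤ angT t ^ 2 * (2 * E) :=
      mul_le_mul_of_nonneg_left hEq2 (by positivity)
    nlinarith
  have hEpos : 0 < E := Real.exp_pos _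
  have hneg : Real.exp (-(z ^ 2) / (4 * angT t)) = E⁻¹ := by
    rw [hE, ← Real.exp_neg, neg_div]
  unfold phiF
  rw [hneg, mul_pow, mul_pow]
  calc (z / (2 * angT t)) ^ 2 * ((E⁻¹) ^ 2 *
        (∫ s in (0 : ℝ)..z, h x y s * Real.exp (s ^ 2 / (4 * angT t))) ^ 2)
      ≤ (z / (2 * angT t)) ^ 2 * ((E⁻¹) ^ 2 * (z * (E * J))) := by gcongr
    _ = z ^ 3 / (4 * angT t ^ 2) * (E⁻¹ * J) := by field_simp; ring
    _ ≤ 9 / 2 * E * (E⁻¹ * J) := by gcongr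
    _ = 9 / 2 * J := by field_simp

/-- The vertical `L^∞` bound of the radial velocity, uniformly in time. -/
theorem ofReal_sq_radialVel_le (hh : SmoothXYZ h) {t : ℝ} (ht : 0 ≤ t) (n : ℕ) (x y : ℝ)
    {z : ℝ} (hz : 0 < z) :
    ENNReal.ofReal ((angR x y ^ n * radialVel t h x y z) ^ 2) ≤
      13 * (vertEnergy t n h x y + vertEnergy t n (pdz h) x y) := by
  have hhc := hh.continuous_slice x y
  have hthc := continuous_thw t 1
  have h1 := ofReal_sq_le_vertEnergy hh ht n x y hz
  have h2 : ENNReal.ofReal ((angR x y ^ n * (z / (2 * angT t) * phiF t h x y z)) ^ 2) ≤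
      ENNReal.ofReal (9 / 2) * vertEnergy t n h x y := by
    have hb : (angR x y ^ n * (z / (2 * angT t) * phiF t h x y z)) ^ 2 ≤
        9 / 2 * ∫ s in (0 : ℝ)..z, (thw t 1 s * angR x y ^ n * h x y s) ^ 2 := by
      have e : ∀ s, (thw t 1 s * angR x y ^ n * h x y s) ^ 2 =
          (angR x y ^ n) ^ 2 * (thw t 1 s * h x y s) ^ 2 := fun s => by ring
      simp only [e]
      rw [intervalIntegral.integral_const_mul, mul_pow, mul_left_comm]
      exact mul_le_mul_of_nonneg_left (sq_phiF_term_le hh ht x y hz) (sq_nonneg _)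
    refine (ENNReal.ofReal_le_ofReal hb).trans ?_
    rw [ENNReal.ofReal_mul (by norm_num), intervalIntegral.integral_of_le hz.le,
      ofReal_integral_eq_lintegral_ofReal
        (by fun_prop : Continuous fun s => (thw t 1 s * angR x y ^ n * h x y s) ^ 2).integrableOn_Ioc
        (ae_of_all _ fun s => sq_nonneg _)]
    exact mul_le_mul_right (lintegral_mono_set Ioc_subset_Ioi_self) _
  have h3 : (angR x y ^ n * radialVel t h x y z) ^ 2 ≤ 2 * (angR x y ^ n * h x y z) ^ 2 +
      2 * (angR x y ^ n * (z / (2 * angT t) * phiF t h x y z)) ^ 2 := by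
    unfold radialVel
    nlinarith [sq_nonneg (angR x y ^ n * h x y z +
      angR x y ^ n * (z / (2 * angT t) * phiF t h x y z))]
  refine (ENNReal.ofReal_le_ofReal h3).trans ?_
  rw [ENNReal.ofReal_add (by positivity) (by positivity), ENNReal.ofReal_mul (by norm_num),
    ENNReal.ofReal_mul (by norm_num), ENNReal.ofReal_ofNat]
  calc _ ≤ 2 * (2 * (vertEnergy t n h x y + vertEnergy t n (pdz h) x y)) +
        2 * (ENNReal.ofReal (9 / 2) * vertEnergy t n h x y) := by gcongr
    _ ≤ 2 * (2 * (vertEnergy t n h x y + vertEnergy t n (pdz h) x y)) +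
        2 * (ENNReal.ofReal (9 / 2) * (vertEnergy t n h x y + vertEnergy t n (pdz h) x y)) := by
      gcongr
      exact le_self_add
    _ = _ := by
      rw [← mul_assoc, ← mul_assoc, ← add_mul]
      congr 1
      rw [← ENNReal.ofReal_ofNat 2, ← ENNReal.ofReal_mul (by norm_num),
        ← ENNReal.ofReal_mul (by norm_num), ← ENNReal.ofReal_add (by norm_num) (by norm_num)]
      norm_num

end energies

/-- Lebesgue measure on the half-space `ℝ² × (0,∞)`. -/
def halfSpace : Measure (ℝ × ℝ × ℝ) :=
  (volume : Measure ℝ).prod ((volume : Measure ℝ).prod (volume.restrict (Ioi (0 : ℝ))))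

theorem restrict_pos_eq_halfSpace :
    (volume : Measure (ℝ × ℝ × ℝ)).restrict {p | 0 < p.2.2} = halfSpace := by
  have hs : {p : ℝ × ℝ × ℝ | 0 < p.2.2} = univ ×ˢ (univ ×ˢ Ioi (0 : ℝ)) := by
    ext p
    simp
  rw [hs, Measure.volume_eq_prod, ← Measure.prod_restrict, Measure.volume_eq_prod,
    ← Measure.prod_restrict, Measure.restrict_univ, halfSpace]

theorem lintegral_halfSpace {F : ℝ × ℝ × ℝ → ℝ≥0∞} (hF : Measurable F) :
    ∫⁻ p, F p ∂halfSpace = ∫⁻ x, ∫⁻ y, ∫⁻ z in Ioi (0 : ℝ), F (x, y, z) := by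
  rw [halfSpace, lintegral_prod _ hF.aemeasurable]
  exact lintegral_congr fun x =>
    lintegral_prod _ (hF.comp measurable_prodMk_left).aemeasurable

theorem integral_halfSpace {F : ℝ × ℝ × ℝ → ℝ} (hF : Integrable F halfSpace) :
    ∫ p, F p ∂halfSpace = ∫ x, ∫ y, ∫ z in Ioi (0 : ℝ), F (x, y, z) := by
  rw [halfSpace] at hF ⊢
  rw [integral_prod _ hF]
  refine integral_congr_ae ?_
  filter_upwards [hF.prod_right_ae] with x hx
  exact integral_prod _ hx

theorem ofReal_abs_trip_le (F : ℝ → ℝ → ℝ → ℝ) :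
    ENNReal.ofReal |trip F| ≤ ∫⁻ x, ∫⁻ y, ∫⁻ z in Ioi (0 : ℝ), ENNReal.ofReal |F x y z| := by
  simp only [← Real.enorm_eq_ofReal_abs]
  refine (enorm_integral_le_lintegral_enorm _).trans (lintegral_mono fun x => ?_)
  refine (enorm_integral_le_lintegral_enorm _).trans (lintegral_mono fun y => ?_)
  exact enorm_integral_le_lintegral_enorm _

theorem lintegral_ofReal_abs_mul_le {α : Type*} [MeasurableSpace α] {μ : Measure α} {u v : α → ℝ}
    (hu : Measurable u) (hv : Measurable v) {A B : ℝ} (hA : 0 ≤ A) (hB : 0 ≤ B)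
    (huA : ∫⁻ p, ENNReal.ofReal (u p ^ 2) ∂μ ≤ ENNReal.ofReal (A ^ 2))
    (hvB : ∫⁻ p, ENNReal.ofReal (v p ^ 2) ∂μ ≤ ENNReal.ofReal (B ^ 2)) :
    ∫⁻ p, ENNReal.ofReal (|u p| * |v p|) ∂μ ≤ ENNReal.ofReal (A * B) := by
  have hsq : ∀ r : ℝ, ENNReal.ofReal |r| ^ (2 : ℝ) = ENNReal.ofReal (r ^ 2) := fun r => by
    rw [ENNReal.rpow_ofNat, ← ENNReal.ofReal_pow (abs_nonneg r), sq_abs]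
  have hroot : ∀ {c : ℝ} {e : ℝ≥0∞}, 0 ≤ c → e ≤ ENNReal.ofReal (c ^ 2) →
      e ^ (1 / (2 : ℝ)) ≤ ENNReal.ofReal c := fun {c e} hc he => by
    rw [← abs_of_nonneg hc, one_div, ENNReal.rpow_inv_le_iff (by norm_num), hsq]
    exact he
  have h := ENNReal.lintegral_mul_le_Lp_mul_Lq μ Real.HolderConjugate.two_two
    hu.abs.ennreal_ofReal.aemeasurable hv.abs.ennreal_ofReal.aemeasurable
  simp only [Pi.mul_apply, hsq] at h
  simp only [ENNReal.ofReal_mul (abs_nonneg _), ENNReal.ofReal_mul hA]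
  exact h.trans (mul_le_mul' (hroot hA huA) (hroot hB hvB))

theorem energy_eq_ofReal_sq {t : ℝ} {n : ℕ} {h : ℝ → ℝ → ℝ → ℝ}
    (hh : Continuous fun p : ℝ × ℝ × ℝ => h p.1 p.2.1 p.2.2)
    (hi : Integrable (fun p : ℝ × ℝ × ℝ => (thw t 1 p.2.2 * angR p.1 p.2.1 ^ n *
      h p.1 p.2.1 p.2.2) ^ 2) (volume.restrict {p : ℝ × ℝ × ℝ | 0 < p.2.2})) :
    energy t n h = ENNReal.ofReal (L2w t 1 n h ^ 2) := by
  rw [restrict_pos_eq_halfSpace] at hi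
  have h1 := integral_halfSpace hi
  have h2 : 0 ≤ ∫ x : ℝ, ∫ y : ℝ, ∫ z in Ioi (0 : ℝ), (thw t 1 z * angR x y ^ n * h x y z) ^ 2 :=
    integral_nonneg fun x => integral_nonneg fun y => integral_nonneg fun z => sq_nonneg _
  rw [L2w, Real.sq_sqrt h2]
  refine Eq.trans ?_ (congrArg ENNReal.ofReal h1)
  rw [ofReal_integral_eq_lintegral_ofReal hi (ae_of_all _ fun p => sq_nonneg _)]
  exact (lintegral_halfSpace (measurable_wsq t n hh)).symm

/-- The weighted norm `‖θ ⟨r⟩^{a+b} ∂^{(a,b)}_h g‖_{L²}`. -/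
def tanNorm (t : ℝ) (g : ℝ → ℝ → ℝ → ℝ) (a b : ℕ) : ℝ := L2w t 1 (a + b) (pdh a b g)

/-- The sum of a function on `ℕ²` over the unit square with corner `(a, b)`. -/
def squareSum (f : ℕ → ℕ → ℝ) (a b : ℕ) : ℝ :=
  f a b + f a (b + 1) + (f (a + 1) b + f (a + 1) (b + 1))

theorem tanNorm_nonneg (t : ℝ) (g : ℝ → ℝ → ℝ → ℝ) (a b : ℕ) : 0 ≤ tanNorm t g a b :=
  Real.sqrt_nonneg _

theorem squareSum_nonneg {f : ℕ → ℕ → ℝ} (hf : ∀ a b, 0 ≤ f a b) (a b : ℕ) :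
    0 ≤ squareSum f a b :=
  add_nonneg (add_nonneg (hf _ _) (hf _ _)) (add_nonneg (hf _ _) (hf _ _))

section products

variable {t : ℝ} {g : ℝ → ℝ → ℝ → ℝ}

theorem energy_pdh (hg : SmoothXYZ g) (hL : L2cond t g) (a b : ℕ) :
    energy t (a + b) (pdh a b g) = ENNReal.ofReal (tanNorm t g a b ^ 2) :=
  energy_eq_ofReal_sq (hg.pdh a b).continuous (hL a b)

theorem vertEnergy_pdh_le (hg : SmoothXYZ g) (hL : L2cond t g) (a b : ℕ) (x y : ℝ) :
    vertEnergy t (a + b) (pdh a b g) x y ≤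
      ENNReal.ofReal (4 * squareSum (tanNorm t g) a b ^ 2) := by
  have h := vertEnergy_le_energy (hg.pdh a b) t (a + b) x y
  rw [hg.pdy_pdh, pdx_pdh, hg.pdy_pdh, show a + b + 1 = a + (b + 1) by ring, energy_pdh hg hL,
    energy_pdh hg hL, show a + (b + 1) = a + 1 + b by ring, energy_pdh hg hL,
    show a + b + 2 = a + 1 + (b + 1) by ring, energy_pdh hg hL,
    ← ENNReal.ofReal_add (by positivity) (by positivity),
    ← ENNReal.ofReal_add (by positivity) (by positivity),
    ← ENNReal.ofReal_add (by positivity) (by positivity), ← ENNReal.ofReal_ofNat 4,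
    ← ENNReal.ofReal_mul (by norm_num)] at h
  refine h.trans (ENNReal.ofReal_le_ofReal ?_)
  have h1 := tanNorm_nonneg t g a b
  have h2 := tanNorm_nonneg t g a (b + 1)
  have h3 := tanNorm_nonneg t g (a + 1) b
  have h4 := tanNorm_nonneg t g (a + 1) (b + 1)
  unfold squareSum
  nlinarith [mul_nonneg h1 h2, mul_nonneg h1 h3, mul_nonneg h1 h4, mul_nonneg h2 h3,
    mul_nonneg h2 h4, mul_nonneg h3 h4]

/-- `‖θ ⟨r⟩^{|α|} ∂^α_h g‖ + ‖θ ⟨r⟩^{|α|} ∂^α_h ∂_z g‖` -/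
def tanNormZ (t : ℝ) (g : ℝ → ℝ → ℝ → ℝ) (a b : ℕ) : ℝ := tanNorm t g a b + tanNorm t (pdz g) a b

theorem tanNormZ_nonneg (t : ℝ) (g : ℝ → ℝ → ℝ → ℝ) (a b : ℕ) : 0 ≤ tanNormZ t g a b :=
  add_nonneg (tanNorm_nonneg _ _ _ _) (tanNorm_nonneg _ _ _ _)

/-- The weighted product `θ ⟨r⟩^{|β|+|γ|} ∂^β_h u^r ∂^γ_h g` for `β = (i, j)`, `γ = (p, q)`. -/
def velProd (t : ℝ) (g : ℝ → ℝ → ℝ → ℝ) (i j p q : ℕ) (x y z : ℝ) : ℝ :=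
  angR x y ^ (i + j) * radialVel t (pdh i j g) x y z *
    (thw t 1 z * angR x y ^ (p + q) * pdh p q g x y z)

theorem ofReal_sq_velProd_le (hg : SmoothXYZ g) (ht : 0 ≤ t) (i j p q : ℕ) (x y : ℝ) {z : ℝ}
    (hz : 0 < z) :
    ENNReal.ofReal (velProd t g i j p q x y z ^ 2) ≤
      13 * (vertEnergy t (i + j) (pdh i j g) x y + vertEnergy t (i + j) (pdh i j (pdz g)) x y) *
        wsq t (p + q) (pdh p q g) x y z := by
  unfold velProd
  rw [mul_pow, ENNReal.ofReal_mul (sq_nonneg _)]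
  have h := ofReal_sq_radialVel_le (hg.pdh i j) ht (i + j) x y hz
  rw [hg.pdz_pdh] at h
  exact mul_le_mul' h le_rfl

theorem lintegral_sq_velProd_le (hg : SmoothXYZ g) (ht : 0 ≤ t) (i j p q : ℕ) (x y : ℝ) :
    ∫⁻ z in Ioi (0 : ℝ), ENNReal.ofReal (velProd t g i j p q x y z ^ 2) ≤
      13 * (vertEnergy t (i + j) (pdh i j g) x y + vertEnergy t (i + j) (pdh i j (pdz g)) x y) *
        vertEnergy t (p + q) (pdh p q g) x y := by
  refine (setLIntegral_mono' measurableSet_Ioi fun z hz =>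
    ofReal_sq_velProd_le hg ht i j p q x y hz).trans_eq ?_
  exact lintegral_const_mul _ (measurable_wsq_comp t _ (hg.pdh p q).continuous (by fun_prop)
    (by fun_prop) (by fun_prop))

theorem measurable_velProd (hg : SmoothXYZ g) (t : ℝ) (i j p q : ℕ) :
    Measurable fun w : ℝ × ℝ × ℝ => velProd t g i j p q w.1 w.2.1 w.2.2 := by
  have h1 := continuous_angR
  have h2 := (continuous_thw t 1).comp (by fun_prop : Continuous fun p : ℝ × ℝ × ℝ => p.2.2)
  have h3 := (hg.pdh i j).continuous_radialVel t
  have h4 := (hg.pdh p q).continuous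
  exact (((h1.pow _).mul h3).mul ((h2.mul (h1.pow _)).mul h4)).measurable

theorem lintegral_halfSpace_sq_velProd (hg : SmoothXYZ g) (t : ℝ) (i j p q : ℕ) :
    ∫⁻ w, ENNReal.ofReal (velProd t g i j p q w.1 w.2.1 w.2.2 ^ 2) ∂halfSpace =
      ∫⁻ x, ∫⁻ y, ∫⁻ z in Ioi (0 : ℝ), ENNReal.ofReal (velProd t g i j p q x y z ^ 2) :=
  lintegral_halfSpace (F := fun w => ENNReal.ofReal (velProd t g i j p q w.1 w.2.1 w.2.2 ^ 2))
    ((measurable_velProd hg t i j p q).pow_const 2).ennreal_ofReal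

theorem squareSum_add (f f' : ℕ → ℕ → ℝ) (a b : ℕ) :
    squareSum (fun a b => f a b + f' a b) a b = squareSum f a b + squareSum f' a b := by
  unfold squareSum
  ring

/-- Product estimate with `L^∞` in the horizontal variables on the velocity factor. -/
theorem lintegral_sq_velProd_le_squareSum_mul (hg : SmoothXYZ g) (ht : 0 ≤ t) (hL : L2cond t g)
    (hZ : L2condZ t g) (i j p q : ℕ) :
    ∫⁻ w, ENNReal.ofReal (velProd t g i j p q w.1 w.2.1 w.2.2 ^ 2) ∂halfSpace ≤
      ENNReal.ofReal ((8 * squareSum (tanNormZ t g) i j * tanNorm t g p q) ^ 2) := by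
  have hle : ∀ x y, 13 * (vertEnergy t (i + j) (pdh i j g) x y +
      vertEnergy t (i + j) (pdh i j (pdz g)) x y) ≤
      ENNReal.ofReal ((8 * squareSum (tanNormZ t g) i j) ^ 2) := by
    intro x y
    refine (mul_le_mul_right (add_le_add (vertEnergy_pdh_le hg hL i j x y)
      (vertEnergy_pdh_le hg.pdz hZ i j x y)) _).trans ?_
    rw [← ENNReal.ofReal_add (by positivity) (by positivity), ← ENNReal.ofReal_ofNat 13,
      ← ENNReal.ofReal_mul (by norm_num)]
    refine ENNReal.ofReal_le_ofReal ?_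
    have h1 := squareSum_nonneg (tanNorm_nonneg t g) i j
    have h2 := squareSum_nonneg (tanNorm_nonneg t (pdz g)) i j
    have h3 : squareSum (tanNormZ t g) i j = _ :=
      squareSum_add (tanNorm t g) (tanNorm t (pdz g)) i j
    rw [h3]
    nlinarith [mul_nonneg h1 h2, sq_nonneg (squareSum (tanNorm t g) i j),
      sq_nonneg (squareSum (tanNorm t (pdz g)) i j)]
  rw [lintegral_halfSpace_sq_velProd hg, mul_pow, ENNReal.ofReal_mul (sq_nonneg _),
    ← energy_pdh hg hL, energy, ← lintegral_const_mul' _ _ ENNReal.ofReal_ne_top]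
  refine lintegral_mono fun x => ?_
  simp only
  rw [← lintegral_const_mul' _ _ ENNReal.ofReal_ne_top]
  exact lintegral_mono fun y => (lintegral_sq_velProd_le hg ht i j p q x y).trans
    (mul_le_mul' (hle x y) le_rfl)

/-- Product estimate with `L^∞` in the horizontal variables on the transported factor. -/
theorem lintegral_sq_velProd_le_mul_squareSum (hg : SmoothXYZ g) (ht : 0 ≤ t) (hL : L2cond t g)
    (hZ : L2condZ t g) (i j p q : ℕ) :
    ∫⁻ w, ENNReal.ofReal (velProd t g i j p q w.1 w.2.1 w.2.2 ^ 2) ∂halfSpace ≤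
      ENNReal.ofReal ((8 * tanNormZ t g i j * squareSum (tanNorm t g) p q) ^ 2) := by
  set c := ENNReal.ofReal (13 * (4 * squareSum (tanNorm t g) p q ^ 2)) with hc
  have hle : ∀ x y, ∫⁻ z in Ioi (0 : ℝ), ENNReal.ofReal (velProd t g i j p q x y z ^ 2) ≤
      c * (vertEnergy t (i + j) (pdh i j g) x y +
        vertEnergy t (i + j) (pdh i j (pdz g)) x y) := by
    intro x y
    refine (lintegral_sq_velProd_le hg ht i j p q x y).trans ?_
    rw [hc, ENNReal.ofReal_mul (by norm_num), ENNReal.ofReal_ofNat, mul_assoc, mul_assoc]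
    refine mul_le_mul_right ?_ _
    rw [mul_comm]
    exact mul_le_mul' (vertEnergy_pdh_le hg hL p q x y) le_rfl
  rw [lintegral_halfSpace_sq_velProd hg]
  calc _ ≤ ∫⁻ x, ∫⁻ y, c * (vertEnergy t (i + j) (pdh i j g) x y +
        vertEnergy t (i + j) (pdh i j (pdz g)) x y) :=
        lintegral_mono fun x => lintegral_mono fun y => hle x y
    _ = ∫⁻ x, c * ((∫⁻ y, vertEnergy t (i + j) (pdh i j g) x y) +
        ∫⁻ y, vertEnergy t (i + j) (pdh i j (pdz g)) x y) := by
        refine lintegral_congr fun x => ?_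
        rw [lintegral_const_mul' _ _ ENNReal.ofReal_ne_top, lintegral_add_left]
        exact measurable_vertEnergy_comp t _ (hg.pdh i j).continuous (by fun_prop) (by fun_prop)
    _ = c * (energy t (i + j) (pdh i j g) + energy t (i + j) (pdh i j (pdz g))) := by
        rw [lintegral_const_mul' _ _ ENNReal.ofReal_ne_top, lintegral_add_left]
        · rfl
        · exact measurable_lintegral_vertEnergy _ _ (hg.pdh i j).continuous
    _ ≤ _ := by
        rw [energy_pdh hg hL, energy_pdh hg.pdz hZ,
          ← ENNReal.ofReal_add (by positivity) (by positivity), hc,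
          ← ENNReal.ofReal_mul (by positivity)]
        refine ENNReal.ofReal_le_ofReal ?_
        have h1 := tanNorm_nonneg t g i j
        have h2 := tanNorm_nonneg t (pdz g) i j
        rw [show tanNormZ t g i j = tanNorm t g i j + tanNorm t (pdz g) i j from rfl]
        have h3 : 13 * 4 * (tanNorm t g i j ^ 2 + tanNorm t (pdz g) i j ^ 2) ≤
            64 * (tanNorm t g i j + tanNorm t (pdz g) i j) ^ 2 := by
          nlinarith [mul_nonneg h1 h2, sq_nonneg (tanNorm t g i j),
            sq_nonneg (tanNorm t (pdz g) i j)]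
        nlinarith [mul_le_mul_of_nonneg_left h3 (sq_nonneg (squareSum (tanNorm t g) p q))]

end products

/-- The integral of the nonnegative measurable function `F` is at most the real number `K`. -/
structure IntegralBound {α : Type*} [MeasurableSpace α] (μ : Measure α) (F : α → ℝ) (K : ℝ) :
    Prop where
  measurable : Measurable F
  nonneg : ∀ p, 0 ≤ F p
  bound_nonneg : 0 ≤ K
  lintegral_le : ∫⁻ p, ENNReal.ofReal (F p) ∂μ ≤ ENNReal.ofReal K

namespace IntegralBound

variable {α : Type*} [MeasurableSpace α] {μ : Measure α} {F G : α → ℝ} {K L : ℝ}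

theorem add (hF : IntegralBound μ F K) (hG : IntegralBound μ G L) :
    IntegralBound μ (fun p => F p + G p) (K + L) where
  measurable := hF.measurable.add hG.measurable
  nonneg p := add_nonneg (hF.nonneg p) (hG.nonneg p)
  bound_nonneg := add_nonneg hF.bound_nonneg hG.bound_nonneg
  lintegral_le := by
    simp only [fun p => ENNReal.ofReal_add (hF.nonneg p) (hG.nonneg p)]
    rw [lintegral_add_left hF.measurable.ennreal_ofReal,
      ENNReal.ofReal_add hF.bound_nonneg hG.bound_nonneg]
    exact add_le_add hF.lintegral_le hG.lintegral_le

theorem const_mul (hF : IntegralBound μ F K) {c : ℝ} (hc : 0 ≤ c) :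
    IntegralBound μ (fun p => c * F p) (c * K) where
  measurable := hF.measurable.const_mul c
  nonneg p := mul_nonneg hc (hF.nonneg p)
  bound_nonneg := mul_nonneg hc hF.bound_nonneg
  lintegral_le := by
    simp only [ENNReal.ofReal_mul hc]
    rw [lintegral_const_mul' _ _ ENNReal.ofReal_ne_top]
    exact mul_le_mul_right hF.lintegral_le _

theorem sum {ι : Type*} (s : Finset ι) {F : ι → α → ℝ} {K : ι → ℝ}
    (h : ∀ i ∈ s, IntegralBound μ (F i) (K i)) :
    IntegralBound μ (fun p => ∑ i ∈ s, F i p) (∑ i ∈ s, K i) := by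
  classical
  induction s using Finset.induction_on with
  | empty => exact ⟨by simp, by simp, by simp, by simp⟩
  | insert i s hi ih =>
    simp only [Finset.sum_insert hi]
    exact (h i (Finset.mem_insert_self i s)).add
      (ih fun j hj => h j (Finset.mem_insert_of_mem hj))

end IntegralBound

section transport

variable {t : ℝ} {g : ℝ → ℝ → ℝ → ℝ}

/-- The better of the two product bounds for `velProd`. -/
def velBound (t : ℝ) (g : ℝ → ℝ → ℝ → ℝ) (i j p q : ℕ) : ℝ :=
  min (8 * squareSum (tanNormZ t g) i j * tanNorm t g p q)
    (8 * tanNormZ t g i j * squareSum (tanNorm t g) p q)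

theorem velBound_nonneg (t : ℝ) (g : ℝ → ℝ → ℝ → ℝ) (i j p q : ℕ) : 0 ≤ velBound t g i j p q :=
  le_min
    (mul_nonneg (mul_nonneg (by norm_num) (squareSum_nonneg (tanNormZ_nonneg t g) i j))
      (tanNorm_nonneg t g p q))
    (mul_nonneg (mul_nonneg (by norm_num) (tanNormZ_nonneg t g i j))
      (squareSum_nonneg (tanNorm_nonneg t g) p q))

theorem lintegral_sq_velProd_le_velBound (hg : SmoothXYZ g) (ht : 0 ≤ t) (hL : L2cond t g)
    (hZ : L2condZ t g) (i j p q : ℕ) :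
    ∫⁻ w, ENNReal.ofReal (velProd t g i j p q w.1 w.2.1 w.2.2 ^ 2) ∂halfSpace ≤
      ENNReal.ofReal (velBound t g i j p q ^ 2) := by
  unfold velBound
  rcases min_choice (8 * squareSum (tanNormZ t g) i j * tanNorm t g p q)
    (8 * tanNormZ t g i j * squareSum (tanNorm t g) p q) with h | h
  · rw [h]
    exact lintegral_sq_velProd_le_squareSum_mul hg ht hL hZ i j p q
  · rw [h]
    exact lintegral_sq_velProd_le_mul_squareSum hg ht hL hZ i j p q

theorem integralBound_velProd (hg : SmoothXYZ g) (ht : 0 ≤ t) (hL : L2cond t g)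
    (hZ : L2condZ t g) (a b i j p q : ℕ) :
    IntegralBound halfSpace (fun w : ℝ × ℝ × ℝ =>
      |thw t 1 w.2.2 * angR w.1 w.2.1 ^ (a + b) * pdh a b g w.1 w.2.1 w.2.2| *
        |velProd t g i j p q w.1 w.2.1 w.2.2|) (tanNorm t g a b * velBound t g i j p q) := by
  have hu : Measurable fun w : ℝ × ℝ × ℝ =>
      thw t 1 w.2.2 * angR w.1 w.2.1 ^ (a + b) * pdh a b g w.1 w.2.1 w.2.2 := by
    have h2 := (continuous_thw t 1).comp (by fun_prop : Continuous fun p : ℝ × ℝ × ℝ => p.2.2)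
    exact ((h2.mul (continuous_angR.pow _)).mul (hg.pdh a b).continuous).measurable
  refine ⟨hu.abs.mul (measurable_velProd hg t i j p q).abs, fun w => by positivity,
    mul_nonneg (tanNorm_nonneg t g a b) (velBound_nonneg t g i j p q), ?_⟩
  refine lintegral_ofReal_abs_mul_le hu (measurable_velProd hg t i j p q)
    (tanNorm_nonneg t g a b) (velBound_nonneg t g i j p q) ?_
    (lintegral_sq_velProd_le_velBound hg ht hL hZ i j p q)
  rw [← energy_pdh hg hL, energy]
  exact (lintegral_halfSpace (measurable_wsq t _ (hg.pdh a b).continuous)).le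

/-- The bound for the weighted product of `∂^β_h u^r` and `∂^γ_h (r∂_r g)`, `β = (i, j)`,
`γ = (p, q)`. -/
def transportBound (t : ℝ) (g : ℝ → ℝ → ℝ → ℝ) (i j p q : ℕ) : ℝ :=
  velBound t g i j (p + 1) q + velBound t g i j p (q + 1) +
    ((p + q : ℕ) : ℝ) * velBound t g i j p q

theorem abs_weighted_radialVel_mul_rdrDeriv_le (t : ℝ) (g : ℝ → ℝ → ℝ → ℝ) (i j p q : ℕ)
    (x y z : ℝ) :
    |thw t 1 z * angR x y ^ (i + j + (p + q)) *
        (radialVel t (pdh i j g) x y z * rdrDeriv g p q x y z)| ≤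
      |velProd t g i j (p + 1) q x y z| + |velProd t g i j p (q + 1) x y z| +
        ((p + q : ℕ) : ℝ) * |velProd t g i j p q x y z| := by
  have hR := angR_pos x y
  have hw : 0 ≤ thw t 1 z * angR x y ^ (i + j + (p + q)) :=
    mul_nonneg (thw_pos t 1 z).le (pow_nonneg hR.le _)
  obtain ⟨c, hc⟩ : ∃ c, c = thw t 1 z * angR x y ^ (i + j + (p + q)) := ⟨_, rfl⟩
  obtain ⟨v, hv⟩ : ∃ v, v = radialVel t (pdh i j g) x y z := ⟨_, rfl⟩
  rw [← hc] at hw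
  have e1 : |velProd t g i j (p + 1) q x y z| =
      c * |v| * (angR x y * |pdh (p + 1) q g x y z|) := by
    rw [show velProd t g i j (p + 1) q x y z = c * (v * (angR x y * pdh (p + 1) q g x y z)) by
      rw [velProd, hc, hv]; ring]
    rw [abs_mul, abs_mul, abs_mul, abs_of_nonneg hw, abs_of_pos hR]
    ring
  have e2 : |velProd t g i j p (q + 1) x y z| =
      c * |v| * (angR x y * |pdh p (q + 1) g x y z|) := by
    rw [show velProd t g i j p (q + 1) x y z = c * (v * (angR x y * pdh p (q + 1) g x y z)) by
      rw [velProd, hc, hv]; ring]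
    rw [abs_mul, abs_mul, abs_mul, abs_of_nonneg hw, abs_of_pos hR]
    ring
  have e3 : |velProd t g i j p q x y z| = c * |v| * |pdh p q g x y z| := by
    rw [show velProd t g i j p q x y z = c * (v * pdh p q g x y z) by rw [velProd, hc, hv]; ring]
    rw [abs_mul, abs_mul, abs_of_nonneg hw]
    ring
  have hrdr : |rdrDeriv g p q x y z| ≤ angR x y * |pdh (p + 1) q g x y z| +
      angR x y * |pdh p (q + 1) g x y z| + ((p + q : ℕ) : ℝ) * |pdh p q g x y z| := by
    unfold rdrDeriv
    refine (abs_add_three _ _ _).trans ?_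
    rw [abs_mul, abs_mul, abs_mul, Nat.abs_cast]
    gcongr
    · exact abs_fst_le_angR x y
    · exact abs_snd_le_angR x y
  rw [e1, e2, e3, ← hc, ← hv, abs_mul, abs_mul, abs_of_nonneg hw, ← mul_assoc]
  calc _ ≤ c * |v| * (angR x y * |pdh (p + 1) q g x y z| +
      angR x y * |pdh p (q + 1) g x y z| + ((p + q : ℕ) : ℝ) * |pdh p q g x y z|) := by gcongr
    _ = _ := by ring

theorem abs_I1_le (hg : SmoothXYZ g) (ht : 0 ≤ t) (hL : L2cond t g) (hZ : L2condZ t g)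
    (a b : ℕ) :
    |I1 t g a b| ≤ tanNorm t g a b *
      ∑ p ∈ Finset.HasAntidiagonal.antidiagonal a, ∑ q ∈ Finset.HasAntidiagonal.antidiagonal b,
        (a.choose p.1 : ℝ) * (b.choose q.1 : ℝ) * transportBound t g p.1 q.1 p.2 q.2 := by
  set W : ℝ × ℝ × ℝ → ℝ := fun w =>
    thw t 1 w.2.2 * angR w.1 w.2.1 ^ (a + b) * pdh a b g w.1 w.2.1 w.2.2 with hW
  set V : ℕ → ℕ → ℕ → ℕ → ℝ × ℝ × ℝ → ℝ := fun i j p q w =>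
    |velProd t g i j p q w.1 w.2.1 w.2.2| with hV
  have hb : IntegralBound halfSpace
      (fun w => ∑ p ∈ Finset.HasAntidiagonal.antidiagonal a,
        ∑ q ∈ Finset.HasAntidiagonal.antidiagonal b, (a.choose p.1 : ℝ) * (b.choose q.1 : ℝ) *
          (|W w| * V p.1 q.1 (p.2 + 1) q.2 w + |W w| * V p.1 q.1 p.2 (q.2 + 1) w +
            ((p.2 + q.2 : ℕ) : ℝ) * (|W w| * V p.1 q.1 p.2 q.2 w)))
      (∑ p ∈ Finset.HasAntidiagonal.antidiagonal a,
        ∑ q ∈ Finset.HasAntidiagonal.antidiagonal b, (a.choose p.1 : ℝ) * (b.choose q.1 : ℝ) *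
          (tanNorm t g a b * velBound t g p.1 q.1 (p.2 + 1) q.2 +
            tanNorm t g a b * velBound t g p.1 q.1 p.2 (q.2 + 1) +
            ((p.2 + q.2 : ℕ) : ℝ) * (tanNorm t g a b * velBound t g p.1 q.1 p.2 q.2))) := by
    refine IntegralBound.sum _ fun p _ => IntegralBound.sum _ fun q _ =>
      IntegralBound.const_mul (((integralBound_velProd hg ht hL hZ a b _ _ _ _).add
        (integralBound_velProd hg ht hL hZ a b _ _ _ _)).add
        ((integralBound_velProd hg ht hL hZ a b _ _ _ _).const_mul (Nat.cast_nonneg _)))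
        (by positivity)
  have hpt : ∀ x y z, |thw t 2 z * angR x y ^ (2 * (a + b)) *
      pdh a b (fun x' y' z' => ur t g x' y' z' * rdr g x' y' z') x y z * pdh a b g x y z| ≤
      ∑ p ∈ Finset.HasAntidiagonal.antidiagonal a,
        ∑ q ∈ Finset.HasAntidiagonal.antidiagonal b, (a.choose p.1 : ℝ) * (b.choose q.1 : ℝ) *
          (|W (x, y, z)| * V p.1 q.1 (p.2 + 1) q.2 (x, y, z) +
            |W (x, y, z)| * V p.1 q.1 p.2 (q.2 + 1) (x, y, z) +
            ((p.2 + q.2 : ℕ) : ℝ) * (|W (x, y, z)| * V p.1 q.1 p.2 q.2 (x, y, z))) := by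
    intro x y z
    have e : thw t 2 z * angR x y ^ (2 * (a + b)) *
        pdh a b (fun x' y' z' => ur t g x' y' z' * rdr g x' y' z') x y z * pdh a b g x y z =
        ∑ p ∈ Finset.HasAntidiagonal.antidiagonal a,
          ∑ q ∈ Finset.HasAntidiagonal.antidiagonal b, (a.choose p.1 : ℝ) * (b.choose q.1 : ℝ) *
          (W (x, y, z) * (thw t 1 z * angR x y ^ (a + b) *
            (radialVel t (pdh p.1 q.1 g) x y z * rdrDeriv g p.2 q.2 x y z))) := by
      rw [hg.pdh_ur_mul_rdr ht, thw_two, Finset.mul_sum, Finset.sum_mul]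
      refine Finset.sum_congr rfl fun p _ => ?_
      rw [Finset.mul_sum, Finset.sum_mul]
      refine Finset.sum_congr rfl fun q _ => ?_
      simp only [hW]
      ring
    rw [e]
    refine (Finset.abs_sum_le_sum_abs _ _).trans (Finset.sum_le_sum fun p hp => ?_)
    refine (Finset.abs_sum_le_sum_abs _ _).trans (Finset.sum_le_sum fun q hq => ?_)
    have hp' := Finset.HasAntidiagonal.mem_antidiagonal.1 hp
    have hq' := Finset.HasAntidiagonal.mem_antidiagonal.1 hq
    rw [abs_mul, abs_of_nonneg (by positivity : (0 : ℝ) ≤ (a.choose p.1 : ℝ) * (b.choose q.1 : ℝ)),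
      abs_mul, show a + b = p.1 + q.1 + (p.2 + q.2) by omega]
    refine mul_le_mul_of_nonneg_left ?_ (by positivity)
    refine (mul_le_mul_of_nonneg_left (abs_weighted_radialVel_mul_rdrDeriv_le t g p.1 q.1 p.2 q.2
      x y z) (abs_nonneg _)).trans_eq ?_
    simp only [hV]
    ring
  have h1 := ofReal_abs_trip_le fun x y z => thw t 2 z * angR x y ^ (2 * (a + b)) *
      pdh a b (fun x' y' z' => ur t g x' y' z' * rdr g x' y' z') x y z * pdh a b g x y z
  have h2 := (lintegral_mono fun x => lintegral_mono fun y => lintegral_mono fun z =>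
    ENNReal.ofReal_le_ofReal (hpt x y z)).trans
    ((lintegral_halfSpace hb.measurable.ennreal_ofReal).symm.trans_le hb.lintegral_le)
  rw [I1, abs_neg]
  refine ((ENNReal.ofReal_le_ofReal_iff hb.bound_nonneg).1 (h1.trans h2)).trans_eq ?_
  simp only [Finset.mul_sum, transportBound]
  refine Finset.sum_congr rfl fun p _ => Finset.sum_congr rfl fun q _ => ?_
  ring

end transport

section layers

/-- The sum of a function on `ℕ²` over the multi-indices of length `n`. -/
def layer (f : ℕ → ℕ → ℝ) (n : ℕ) : ℝ := ∑ p ∈ Finset.HasAntidiagonal.antidiagonal n, f p.1 p.2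

variable {f : ℕ → ℕ → ℝ}

theorem layer_nonneg (hf : ∀ a b, 0 ≤ f a b) (n : ℕ) : 0 ≤ layer f n :=
  Finset.sum_nonneg fun _ _ => hf _ _

theorem layer_eq_sum_range (f : ℕ → ℕ → ℝ) (n : ℕ) :
    layer f n = ∑ a ∈ Finset.range (n + 1), f a (n - a) :=
  Finset.Nat.sum_antidiagonal_eq_sum_range_succ f n

theorem layer_shift_fst_le (hf : ∀ a b, 0 ≤ f a b) (n : ℕ) :
    layer (fun a b => f (a + 1) b) n ≤ layer f (n + 1) := by
  unfold layer
  rw [Finset.Nat.sum_antidiagonal_succ]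
  exact le_add_of_nonneg_left (hf _ _)

theorem layer_shift_snd_le (hf : ∀ a b, 0 ≤ f a b) (n : ℕ) :
    layer (fun a b => f a (b + 1)) n ≤ layer f (n + 1) := by
  unfold layer
  rw [Finset.Nat.sum_antidiagonal_succ']
  exact le_add_of_nonneg_left (hf _ _)

theorem layer_squareSum_le (hf : ∀ a b, 0 ≤ f a b) (n : ℕ) :
    layer (squareSum f) n ≤ layer f n + 2 * layer f (n + 1) + layer f (n + 2) := by
  have h1 := layer_shift_snd_le hf n
  have h2 := layer_shift_fst_le hf n
  have h3 := (layer_shift_fst_le (f := fun a b => f a (b + 1)) (fun a b => hf _ _) n).trans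
    (layer_shift_snd_le hf (n + 1))
  have h4 : layer (squareSum f) n = layer f n + layer (fun a b => f a (b + 1)) n +
      (layer (fun a b => f (a + 1) b) n + layer (fun a b => f (a + 1) (b + 1)) n) := by
    simp only [layer, squareSum, Finset.sum_add_distrib]
  linarith

/-- The bound for the sum over the layer `m` of the terms produced by `r∂_r`. -/
def transportLayer (f : ℕ → ℕ → ℝ) (m : ℕ) : ℝ := 2 * layer f (m + 1) + m * layer f m

theorem transportLayer_nonneg {f : ℕ → ℕ → ℝ} (hf : ∀ i j, 0 ≤ f i j) (m : ℕ) :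
    0 ≤ transportLayer f m := by
  have h0 := layer_nonneg hf m
  have h1 := layer_nonneg hf (m + 1)
  unfold transportLayer
  positivity

theorem layer_transport_le (hf : ∀ a b, 0 ≤ f a b) (m : ℕ) :
    layer (fun p q => f (p + 1) q + f p (q + 1) + ((p + q : ℕ) : ℝ) * f p q) m ≤
      transportLayer f m := by
  have h1 := layer_shift_snd_le hf m
  have h2 := layer_shift_fst_le hf m
  have h3 : layer (fun p q => f (p + 1) q + f p (q + 1) + ((p + q : ℕ) : ℝ) * f p q) m =
      layer (fun p q => f (p + 1) q) m + layer (fun p q => f p (q + 1)) m + m * layer f m := by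
    simp only [layer, Finset.sum_add_distrib, Finset.mul_sum]
    congr 1
    refine Finset.sum_congr rfl fun p hp => ?_
    rw [Finset.HasAntidiagonal.mem_antidiagonal.1 hp]
  rw [h3, transportLayer]
  linarith

theorem choose_mul_choose_le (a b i j : ℕ) :
    a.choose i * b.choose j ≤ (a + b).choose (i + j) := by
  rw [Nat.add_choose_eq]
  exact Finset.single_le_sum (f := fun ij : ℕ × ℕ => a.choose ij.1 * b.choose ij.2)
    (fun _ _ => Nat.zero_le _) (Finset.HasAntidiagonal.mem_antidiagonal.2 (rfl : (i, j).1 + (i, j).2 = _))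

theorem sum_choose_mul_choose_le {F : ℕ → ℕ → ℕ → ℕ → ℝ} (hF : ∀ i j p q, 0 ≤ F i j p q) (n : ℕ) :
    ∑ c ∈ Finset.HasAntidiagonal.antidiagonal n, ∑ p ∈ Finset.HasAntidiagonal.antidiagonal c.1,
      ∑ q ∈ Finset.HasAntidiagonal.antidiagonal c.2,
        (c.1.choose p.1 : ℝ) * (c.2.choose q.1 : ℝ) * F p.1 q.1 p.2 q.2 ≤
    ∑ c ∈ Finset.HasAntidiagonal.antidiagonal n,
      (n.choose c.1 : ℝ) * layer (fun i j => layer (F i j) c.2) c.1 := by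
  calc _ ≤ ∑ c ∈ Finset.HasAntidiagonal.antidiagonal n,
        ∑ p ∈ Finset.HasAntidiagonal.antidiagonal c.1,
          ∑ q ∈ Finset.HasAntidiagonal.antidiagonal c.2,
            (n.choose (p.1 + q.1) : ℝ) * F p.1 q.1 p.2 q.2 := by
        refine Finset.sum_le_sum fun c hc => Finset.sum_le_sum fun p _ =>
          Finset.sum_le_sum fun q _ => mul_le_mul_of_nonneg_right ?_ (hF _ _ _ _)
        rw [← Finset.HasAntidiagonal.mem_antidiagonal.1 hc]
        exact_mod_cast choose_mul_choose_le c.1 c.2 p.1 q.1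
    _ = ∑ c ∈ Finset.HasAntidiagonal.antidiagonal n,
        ∑ p ∈ Finset.HasAntidiagonal.antidiagonal c.1,
          ∑ q ∈ Finset.HasAntidiagonal.antidiagonal c.2,
            (n.choose (p.1 + p.2) : ℝ) * F p.1 p.2 q.1 q.2 := by
        simp only [Finset.sum_sigma']
        refine Finset.sum_nbij'
          (fun s => ⟨(s.2.1.1 + s.2.2.1, s.2.1.2 + s.2.2.2), (s.2.1.1, s.2.2.1), (s.2.1.2, s.2.2.2)⟩)
          (fun s => ⟨(s.2.1.1 + s.2.2.1, s.2.1.2 + s.2.2.2), (s.2.1.1, s.2.2.1), (s.2.1.2, s.2.2.2)⟩)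
          ?_ ?_ ?_ ?_ ?_
        · rintro ⟨⟨a, b⟩, ⟨i, p⟩, ⟨j, q⟩⟩ hs
          simp only [Finset.mem_sigma, Finset.HasAntidiagonal.mem_antidiagonal] at hs ⊢
          exact ⟨by omega, trivial, trivial⟩
        · rintro ⟨⟨a, b⟩, ⟨i, p⟩, ⟨j, q⟩⟩ hs
          simp only [Finset.mem_sigma, Finset.HasAntidiagonal.mem_antidiagonal] at hs ⊢
          exact ⟨by omega, trivial, trivial⟩
        · rintro ⟨⟨a, b⟩, ⟨i, p⟩, ⟨j, q⟩⟩ hs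
          simp only [Finset.mem_sigma, Finset.HasAntidiagonal.mem_antidiagonal] at hs
          obtain ⟨-, rfl, rfl⟩ := hs
          rfl
        · rintro ⟨⟨a, b⟩, ⟨i, p⟩, ⟨j, q⟩⟩ hs
          simp only [Finset.mem_sigma, Finset.HasAntidiagonal.mem_antidiagonal] at hs
          obtain ⟨-, rfl, rfl⟩ := hs
          rfl
        · rintro ⟨⟨a, b⟩, ⟨i, p⟩, ⟨j, q⟩⟩ hs
          rfl
    _ = _ := by
        refine Finset.sum_congr rfl fun c _ => ?_
        simp only [layer, Finset.mul_sum]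
        refine Finset.sum_congr rfl fun p hp => Finset.sum_congr rfl fun q _ => ?_
        rw [Finset.HasAntidiagonal.mem_antidiagonal.1 hp]

end layers

section transportLayers

variable (t : ℝ) (g : ℝ → ℝ → ℝ → ℝ)

theorem layer_transportBound_le_of_velBound_le {P : ℕ → ℕ → ℝ} {Q : ℕ → ℕ → ℝ}
    (hP : ∀ i j, 0 ≤ P i j) (hQ : ∀ p q, 0 ≤ Q p q)
    (h : ∀ i j p q, velBound t g i j p q ≤ P i j * Q p q) (k m : ℕ) :
    layer (fun i j => layer (transportBound t g i j) m) k ≤ layer P k * transportLayer Q m := by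
  unfold layer
  rw [Finset.sum_mul]
  refine Finset.sum_le_sum fun p _ => ?_
  refine le_trans ?_ (mul_le_mul_of_nonneg_left (layer_transport_le hQ m) (hP p.1 p.2))
  unfold layer
  rw [Finset.mul_sum]
  refine Finset.sum_le_sum fun q _ => ?_
  have h1 := h p.1 p.2 (q.1 + 1) q.2
  have h2 := h p.1 p.2 q.1 (q.2 + 1)
  have h3 := mul_le_mul_of_nonneg_left (h p.1 p.2 q.1 q.2)
    (Nat.cast_nonneg (α := ℝ) (q.1 + q.2))
  unfold transportBound
  linarith

theorem transportBound_nonneg (i j p q : ℕ) : 0 ≤ transportBound t g i j p q :=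
  add_nonneg (add_nonneg (velBound_nonneg _ _ _ _ _ _) (velBound_nonneg _ _ _ _ _ _))
    (mul_nonneg (Nat.cast_nonneg _) (velBound_nonneg _ _ _ _ _ _))

theorem layer_const_mul (c : ℝ) (f : ℕ → ℕ → ℝ) (n : ℕ) :
    layer (fun i j => c * f i j) n = c * layer f n :=
  (Finset.mul_sum _ _ _).symm

theorem layer_transportBound_le_of_low (k m : ℕ) :
    layer (fun i j => layer (transportBound t g i j) m) k ≤
      8 * layer (squareSum (tanNormZ t g)) k * transportLayer (tanNorm t g) m := by
  refine (layer_transportBound_le_of_velBound_le t g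
    (P := fun i j => 8 * squareSum (tanNormZ t g) i j)
    (fun i j => mul_nonneg (by norm_num) (squareSum_nonneg (tanNormZ_nonneg t g) i j))
    (tanNorm_nonneg t g) (fun i j p q => min_le_left _ _) k m).trans_eq ?_
  rw [layer_const_mul]

theorem layer_transportBound_le_of_high (k m : ℕ) :
    layer (fun i j => layer (transportBound t g i j) m) k ≤
      8 * layer (tanNormZ t g) k * transportLayer (squareSum (tanNorm t g)) m := by
  refine (layer_transportBound_le_of_velBound_le t g
    (P := fun i j => 8 * tanNormZ t g i j)
    (fun i j => mul_nonneg (by norm_num) (tanNormZ_nonneg t g i j))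
    (squareSum_nonneg (tanNorm_nonneg t g)) (fun i j p q => min_le_right _ _) k m).trans_eq ?_
  rw [layer_const_mul]

end transportLayers

section norms

variable (t τ : ℝ) (g : ℝ → ℝ → ℝ → ℝ)

theorem sum_L2w_eq_layer (n : ℕ) :
    ∑ a ∈ Finset.range (n + 1), L2w t 1 n (pdh a (n - a) g) = layer (tanNorm t g) n := by
  rw [layer_eq_sum_range]
  refine Finset.sum_congr rfl fun a ha => ?_
  rw [tanNorm, Nat.add_sub_cancel' (Nat.lt_succ_iff.1 (Finset.mem_range.1 ha))]

theorem layer_tanNormZ (n : ℕ) :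
    layer (tanNormZ t g) n = layer (tanNorm t g) n + layer (tanNorm t (pdz g)) n :=
  Finset.sum_add_distrib

/-- `X_n + D_n` -/
def XDel (n : ℕ) : ℝ := layer (tanNormZ t g) n * τ ^ n * Mfac n

theorem XDel_eq (n : ℕ) : XDel t τ g n = Xel t τ g n + Del t τ g n := by
  rw [XDel, Xel, Del, sum_L2w_eq_layer, sum_L2w_eq_layer, layer_tanNormZ]
  ring

theorem Yel_eq (n : ℕ) :
    Yel t τ g n = layer (tanNorm t g) n * τ ^ (n - 1) * n * Mfac n := by
  rw [Yel, sum_L2w_eq_layer]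

theorem Mfac_nonneg (n : ℕ) : 0 ≤ Mfac n := by
  unfold Mfac
  positivity

end norms

section normBounds

variable {t τ : ℝ} {g : ℝ → ℝ → ℝ → ℝ}

theorem Yel_succ (t τ : ℝ) (g : ℝ → ℝ → ℝ → ℝ) (n : ℕ) :
    Yel t τ g (n + 1) = layer (tanNorm t g) (n + 1) * τ ^ n * ((n + 2) ^ 4 / n.factorial) := by
  rw [Yel_eq, Mfac, Nat.factorial_succ, Nat.add_sub_cancel]
  push_cast
  field_simp
  ring

theorem mul_Yel (t τ : ℝ) (g : ℝ → ℝ → ℝ → ℝ) (n : ℕ) :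
    τ * Yel t τ g n = layer (tanNorm t g) n * τ ^ n * n * Mfac n := by
  rw [Yel_eq]
  rcases n with _ | n
  · simp
  · rw [Nat.add_sub_cancel, pow_succ]
    ring

theorem XDel_nonneg (hτ : 0 < τ) (n : ℕ) : 0 ≤ XDel t τ g n :=
  mul_nonneg (mul_nonneg (layer_nonneg (tanNormZ_nonneg t g) n) (pow_nonneg hτ.le n))
    (Mfac_nonneg n)

theorem Yel_nonneg (hτ : 0 < τ) (n : ℕ) : 0 ≤ Yel t τ g n := by
  rw [Yel_eq]
  exact mul_nonneg (mul_nonneg (mul_nonneg (layer_nonneg (tanNorm_nonneg t g) n)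
    (pow_nonneg hτ.le _)) (Nat.cast_nonneg n)) (Mfac_nonneg n)

theorem layer_squareSum_tanNormZ_le (hτ : 0 < τ) (k : ℕ) :
    τ ^ k / k.factorial * layer (squareSum (tanNormZ t g)) k ≤
      XDel t τ g k + 2 / τ * XDel t τ g (k + 1) + 1 / τ ^ 2 * XDel t τ g (k + 2) := by
  have hf : (0 : ℝ) < k.factorial := by positivity
  have hA0 := layer_nonneg (tanNormZ_nonneg t g) k
  have hA1 := layer_nonneg (tanNormZ_nonneg t g) (k + 1)
  have hA2 := layer_nonneg (tanNormZ_nonneg t g) (k + 2)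
  refine (mul_le_mul_of_nonneg_left (layer_squareSum_le (tanNormZ_nonneg t g) k)
    (by positivity)).trans ?_
  unfold XDel
  set A := layer (tanNormZ t g)
  have h0 : 1 ≤ k.factorial * Mfac k := by
    rw [Mfac, mul_div_cancel₀ _ hf.ne']
    exact one_le_pow₀ (by linarith [Nat.cast_nonneg (α := ℝ) k])
  have hk : (0 : ℝ) ≤ k := Nat.cast_nonneg k
  have h1 : 1 ≤ k.factorial * Mfac (k + 1) := by
    have h : (k.factorial : ℝ) * Mfac (k + 1) = (k + 2) ^ 4 / (k + 1) := by
      rw [Mfac, Nat.factorial_succ]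
      push_cast
      field_simp
      ring
    rw [h, le_div_iff₀ (by positivity)]
    nlinarith [pow_nonneg hk 3, pow_nonneg hk 4, sq_nonneg (k : ℝ)]
  have h2 : 1 ≤ k.factorial * Mfac (k + 2) := by
    have h : (k.factorial : ℝ) * Mfac (k + 2) = (k + 3) ^ 4 / ((k + 2) * (k + 1)) := by
      rw [Mfac, Nat.factorial_succ, Nat.factorial_succ]
      push_cast
      field_simp
      ring
    rw [h, le_div_iff₀ (by positivity)]
    nlinarith [pow_nonneg hk 3, pow_nonneg hk 4, sq_nonneg (k : ℝ)]
  calc τ ^ k / k.factorial * (A k + 2 * A (k + 1) + A (k + 2))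
      = τ ^ k / k.factorial * (A k * 1 + 2 * A (k + 1) * 1 + A (k + 2) * 1) := by ring
    _ ≤ τ ^ k / k.factorial * (A k * (k.factorial * Mfac k) +
        2 * A (k + 1) * (k.factorial * Mfac (k + 1)) +
        A (k + 2) * (k.factorial * Mfac (k + 2))) := by gcongr
    _ = _ := by
      field_simp
      ring

theorem transportLayer_tanNorm_le (hτ : 0 < τ) (m : ℕ) :
    τ ^ m * Mfac m * transportLayer (tanNorm t g) m ≤
      2 * Yel t τ g (m + 1) + τ * Yel t τ g m := by
  have hB := layer_nonneg (tanNorm_nonneg t g) (m + 1)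
  rw [mul_Yel, Yel_succ, transportLayer]
  have h : Mfac m ≤ (m + 2) ^ 4 / m.factorial := by
    unfold Mfac
    gcongr
    norm_num
  have h2 : layer (tanNorm t g) (m + 1) * τ ^ m * Mfac m ≤
      layer (tanNorm t g) (m + 1) * τ ^ m * ((m + 2) ^ 4 / m.factorial) := by gcongr
  linarith

theorem transportLayer_squareSum_le (hτ : 0 < τ) (m : ℕ) :
    τ ^ m / m.factorial * transportLayer (squareSum (tanNorm t g)) m ≤
      τ * Yel t τ g m + Yel t τ g (m + 1) + 1 / τ * Yel t τ g (m + 2) +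
        1 / τ ^ 2 * Yel t τ g (m + 3) := by
  have hf : (0 : ℝ) < m.factorial := by positivity
  have hB0 := layer_nonneg (tanNorm_nonneg t g) m
  have hB1 := layer_nonneg (tanNorm_nonneg t g) (m + 1)
  have hB2 := layer_nonneg (tanNorm_nonneg t g) (m + 2)
  have hB3 := layer_nonneg (tanNorm_nonneg t g) (m + 3)
  have hm : (0 : ℝ) ≤ m := Nat.cast_nonneg m
  have hS0 := layer_squareSum_le (tanNorm_nonneg t g) m
  have hS1 := layer_squareSum_le (tanNorm_nonneg t g) (m + 1)
  rw [mul_Yel, Yel_succ, Yel_succ, Yel_succ, transportLayer]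
  set B := layer (tanNorm t g)
  have e2 : ((m + 1).factorial : ℝ) = (m + 1) * m.factorial := by
    rw [Nat.factorial_succ]; push_cast; ring
  have e3 : ((m + 2).factorial : ℝ) = (m + 2) * ((m + 1) * m.factorial) := by
    rw [Nat.factorial_succ, Nat.factorial_succ]; push_cast; ring
  have h0 : (m : ℝ) ≤ m * (m + 1) ^ 4 := le_mul_of_one_le_right hm (one_le_pow₀ (by linarith))
  have h1 : (2 + 2 * m : ℝ) ≤ (m + 2) ^ 4 := by nlinarith [pow_nonneg hm 3, pow_nonneg hm 4, sq_nonneg (m : ℝ)]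
  have h2 : (4 + m : ℝ) ≤ (m + 3) ^ 4 / (m + 1) := by
    rw [le_div_iff₀ (by positivity)]
    nlinarith [pow_nonneg hm 3, pow_nonneg hm 4, sq_nonneg (m : ℝ)]
  have h3 : (2 : ℝ) ≤ (m + 4) ^ 4 / ((m + 2) * (m + 1)) := by
    rw [le_div_iff₀ (by positivity)]
    nlinarith [pow_nonneg hm 3, pow_nonneg hm 4, sq_nonneg (m : ℝ)]
  calc _ ≤ τ ^ m / m.factorial * (2 * (B (m + 1) + 2 * B (m + 2) + B (m + 3)) +
        m * (B m + 2 * B (m + 1) + B (m + 2))) := by gcongr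
    _ = τ ^ m / m.factorial * (B m * m + B (m + 1) * (2 + 2 * m) + B (m + 2) * (4 + m) +
        B (m + 3) * 2) := by ring
    _ ≤ τ ^ m / m.factorial * (B m * (m * (m + 1) ^ 4) + B (m + 1) * (m + 2) ^ 4 +
        B (m + 2) * ((m + 3) ^ 4 / (m + 1)) +
        B (m + 3) * ((m + 4) ^ 4 / ((m + 2) * (m + 1)))) := by gcongr
    _ = _ := by
      push_cast
      rw [e2, e3, Mfac]
      field_simp
      ring

end normBounds

section sums

theorem sum_antidiagonal_mul_le {u v : ℕ → ℝ} (hu : ∀ n, 0 ≤ u n) (hv : ∀ n, 0 ≤ v n) (N : ℕ) :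
    ∑ n ∈ Finset.range N, ∑ c ∈ Finset.HasAntidiagonal.antidiagonal n, u c.1 * v c.2 ≤
      (∑ k ∈ Finset.range N, u k) * ∑ m ∈ Finset.range N, v m := by
  rw [Finset.sum_mul_sum, ← Finset.sum_product', Finset.sum_sigma']
  rw [← Finset.sum_image (g := fun s : (_ : ℕ) × ℕ × ℕ => s.2) (f := fun c => u c.1 * v c.2)]
  · refine Finset.sum_le_sum_of_subset_of_nonneg ?_ fun c _ _ => mul_nonneg (hu _) (hv _)
    intro c hc
    simp only [Finset.mem_image, Finset.mem_sigma, Finset.mem_range,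
      Finset.HasAntidiagonal.mem_antidiagonal] at hc
    obtain ⟨s, ⟨h1, h2⟩, rfl⟩ := hc
    simp only [Finset.mem_product, Finset.mem_range]
    omega
  · rintro ⟨n, c⟩ hs ⟨n', c'⟩ hs' h
    simp only [Finset.coe_sigma, Set.mem_sigma_iff, Finset.mem_coe,
      Finset.HasAntidiagonal.mem_antidiagonal] at hs hs'
    obtain rfl : c = c' := h
    obtain rfl : n = n' := hs.2.symm.trans hs'.2
    rfl

theorem sum_range_shift_le_tsum {u : ℕ → ℝ} (hu : ∀ n, 0 ≤ u n) (hs : Summable u) (j N : ℕ) :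
    ∑ n ∈ Finset.range N, u (n + j) ≤ ∑' n, u n := by
  have h := hs.sum_le_tsum ((Finset.range N).map (addRightEmbedding j)) fun n _ => hu n
  rwa [Finset.sum_map] at h

end sums

section assembly

variable {t τ : ℝ} {g : ℝ → ℝ → ℝ → ℝ}

theorem pow_mul_Mfac_mul_choose (τ : ℝ) (k m : ℕ) :
    τ ^ (k + m) * Mfac (k + m) * ((k + m).choose k : ℝ) =
      ((k + m : ℕ) + 1 : ℝ) ^ 4 * (τ ^ k / k.factorial) * (τ ^ m / m.factorial) := by
  rw [Nat.cast_add_choose, Mfac, pow_add]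
  have := (k + m).factorial_ne_zero
  field_simp

theorem transport_term_le (hτ : 0 < τ) (k m : ℕ) :
    τ ^ (k + m) * Mfac (k + m) * ((k + m).choose k : ℝ) *
        layer (fun i j => layer (transportBound t g i j) m) k ≤
      128 * ((XDel t τ g k + 2 / τ * XDel t τ g (k + 1) + 1 / τ ^ 2 * XDel t τ g (k + 2)) *
          (2 * Yel t τ g (m + 1) + τ * Yel t τ g m) +
        XDel t τ g k * (τ * Yel t τ g m + Yel t τ g (m + 1) + 1 / τ * Yel t τ g (m + 2) +
          1 / τ ^ 2 * Yel t τ g (m + 3))) := by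
  have hX := XDel_nonneg (t := t) (g := g) hτ
  have hY := Yel_nonneg (t := t) (g := g) hτ
  have hX0 := hX k
  have hX1 := hX (k + 1)
  have hX2 := hX (k + 2)
  have hY0 := hY m
  have hY1 := hY (m + 1)
  have hY2 := hY (m + 2)
  have hY3 := hY (m + 3)
  have hS := layer_nonneg (squareSum_nonneg (tanNormZ_nonneg t g)) k
  have hZ := layer_nonneg (tanNormZ_nonneg t g) k
  have hT := transportLayer_tanNorm_le (t := t) (g := g) hτ m
  have hT' := transportLayer_squareSum_le (t := t) (g := g) hτ m
  have hE := layer_squareSum_tanNormZ_le (t := t) (g := g) hτ k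
  have hM := Mfac_nonneg m
  have hB := transportLayer_nonneg (tanNorm_nonneg t g) m
  have hB' := transportLayer_nonneg (squareSum_nonneg (tanNorm_nonneg t g)) m
  rw [pow_mul_Mfac_mul_choose]
  rcases le_total k m with h | h
  · have h4 : ((k + m : ℕ) + 1 : ℝ) ^ 4 ≤ 16 * (m + 1) ^ 4 := by
      have : (k : ℝ) ≤ m := by exact_mod_cast h
      calc ((k + m : ℕ) + 1 : ℝ) ^ 4 ≤ (2 * (m + 1)) ^ 4 := by
            gcongr
            push_cast
            linarith
        _ = _ := by ring
    calc _ ≤ ((k + m : ℕ) + 1 : ℝ) ^ 4 * (τ ^ k / k.factorial) * (τ ^ m / m.factorial) *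
          (8 * layer (squareSum (tanNormZ t g)) k * transportLayer (tanNorm t g) m) := by
          gcongr
          exact layer_transportBound_le_of_low t g k m
      _ ≤ (16 * (m + 1) ^ 4) * (τ ^ k / k.factorial) * (τ ^ m / m.factorial) *
          (8 * layer (squareSum (tanNormZ t g)) k * transportLayer (tanNorm t g) m) := by
          gcongr
      _ = 128 * ((τ ^ k / k.factorial * layer (squareSum (tanNormZ t g)) k) *
          (τ ^ m * Mfac m * transportLayer (tanNorm t g) m)) := by
          rw [Mfac]
          ring
      _ ≤ 128 * ((XDel t τ g k + 2 / τ * XDel t τ g (k + 1) + 1 / τ ^ 2 * XDel t τ g (k + 2)) *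
          (2 * Yel t τ g (m + 1) + τ * Yel t τ g m)) := by
          gcongr
      _ ≤ _ := by
          gcongr
          exact le_add_of_nonneg_right (by positivity)
  · have h4 : ((k + m : ℕ) + 1 : ℝ) ^ 4 ≤ 16 * (k + 1) ^ 4 := by
      have : (m : ℝ) ≤ k := by exact_mod_cast h
      calc ((k + m : ℕ) + 1 : ℝ) ^ 4 ≤ (2 * (k + 1)) ^ 4 := by
            gcongr
            push_cast
            linarith
        _ = _ := by ring
    calc _ ≤ ((k + m : ℕ) + 1 : ℝ) ^ 4 * (τ ^ k / k.factorial) * (τ ^ m / m.factorial) *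
          (8 * layer (tanNormZ t g) k * transportLayer (squareSum (tanNorm t g)) m) := by
          gcongr
          exact layer_transportBound_le_of_high t g k m
      _ ≤ (16 * (k + 1) ^ 4) * (τ ^ k / k.factorial) * (τ ^ m / m.factorial) *
          (8 * layer (tanNormZ t g) k * transportLayer (squareSum (tanNorm t g)) m) := by
          gcongr
      _ = 128 * (XDel t τ g k *
          (τ ^ m / m.factorial * transportLayer (squareSum (tanNorm t g)) m)) := by
          rw [XDel, Mfac]
          ring
      _ ≤ 128 * (XDel t τ g k * (τ * Yel t τ g m + Yel t τ g (m + 1) + 1 / τ * Yel t τ g (m + 2) +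
          1 / τ ^ 2 * Yel t τ g (m + 3))) := by
          gcongr
      _ ≤ _ := by
          gcongr
          exact le_add_of_nonneg_left (by positivity)

theorem Qterm_I1_le (hg : SmoothXYZ g) (ht : 0 ≤ t) (hL : L2cond t g) (hZ : L2condZ t g)
    (hτ : 0 < τ) (n : ℕ) :
    Qterm t τ g (I1 t g) n ≤ τ ^ n * Mfac n * ∑ c ∈ Finset.HasAntidiagonal.antidiagonal n,
      (n.choose c.1 : ℝ) * layer (fun i j => layer (transportBound t g i j) c.2) c.1 := by
  have hM := Mfac_nonneg n
  refine le_trans ?_ (mul_le_mul_of_nonneg_left (sum_choose_mul_choose_le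
    (transportBound_nonneg t g) n) (by positivity))
  rw [Qterm, Finset.mul_sum, Finset.Nat.sum_antidiagonal_eq_sum_range_succ_mk]
  refine Finset.sum_le_sum fun a ha => ?_
  have hn : L2w t 1 n (pdh a (n - a) g) = tanNorm t g a (n - a) := by
    rw [tanNorm, Nat.add_sub_cancel' (Finset.mem_range_succ_iff.1 ha)]
  rw [hn]
  refine div_le_of_le_mul₀ (tanNorm_nonneg t g _ _) ?_ ?_
  · exact mul_nonneg (by positivity) (Finset.sum_nonneg fun p _ => Finset.sum_nonneg fun q _ =>
      mul_nonneg (by positivity) (transportBound_nonneg t g _ _ _ _))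
  · have h := abs_I1_le hg ht hL hZ a (n - a)
    calc _ = τ ^ n * Mfac n * |I1 t g a (n - a)| := by ring
      _ ≤ τ ^ n * Mfac n * _ := mul_le_mul_of_nonneg_left h (by positivity)
      _ = _ := by ring

theorem sum_Qterm_I1_le (hg : SmoothXYZ g) (ht : 0 ≤ t) (hL : L2cond t g) (hZ : L2condZ t g)
    (hτ : 0 < τ) (hX : Summable (Xel t τ g)) (hD : Summable (Del t τ g))
    (hY : Summable (Yel t τ g)) (N : ℕ) :
    ∑ n ∈ Finset.range N, Qterm t τ g (I1 t g) n ≤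
      128 * ((1 + 2 / τ + 1 / τ ^ 2) * (2 + τ) + (τ + 1 + 1 / τ + 1 / τ ^ 2)) *
        (Xnrm t τ g + Dnrm t τ g) * Ynrm t τ g := by
  have hE : Summable (XDel t τ g) := by
    rw [funext fun n => XDel_eq t τ g n]
    exact hX.add hD
  have hEs : ∑' n, XDel t τ g n = Xnrm t τ g + Dnrm t τ g := by
    rw [Xnrm, Dnrm, ← hX.tsum_add hD]
    exact tsum_congr fun n => XDel_eq t τ g n
  have hE0 := XDel_nonneg (t := t) (g := g) hτ
  have hY0 := Yel_nonneg (t := t) (g := g) hτ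
  set E := XDel t τ g
  set Y := Yel t τ g
  set e : ℕ → ℝ := fun k => E k + 2 / τ * E (k + 1) + 1 / τ ^ 2 * E (k + 2) with he
  set y : ℕ → ℝ := fun m => 2 * Y (m + 1) + τ * Y m with hy
  set y' : ℕ → ℝ := fun m => τ * Y m + Y (m + 1) + 1 / τ * Y (m + 2) + 1 / τ ^ 2 * Y (m + 3)
    with hy'
  have he0 : ∀ k, 0 ≤ e k := fun k => by
    have h0 := hE0 k
    have h1 := hE0 (k + 1)
    have h2 := hE0 (k + 2)
    positivity
  have hy0 : ∀ m, 0 ≤ y m := fun m => by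
    have h0 := hY0 m
    have h1 := hY0 (m + 1)
    positivity
  have hy0' : ∀ m, 0 ≤ y' m := fun m => by
    have h0 := hY0 m
    have h1 := hY0 (m + 1)
    have h2 := hY0 (m + 2)
    have h3 := hY0 (m + 3)
    positivity
  have sE := sum_range_shift_le_tsum hE0 hE
  have sY := sum_range_shift_le_tsum hY0 hY
  rw [hEs] at sE
  change ∀ j N, _ ≤ Ynrm t τ g at sY
  have hS : 0 ≤ Xnrm t τ g + Dnrm t τ g := hEs ▸ tsum_nonneg hE0
  have hR : 0 ≤ Ynrm t τ g := tsum_nonneg hY0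
  set S := Xnrm t τ g + Dnrm t τ g
  set R := Ynrm t τ g
  have h0 : ∑ k ∈ Finset.range N, E k ≤ S := sE 0 N
  have h1 : ∑ k ∈ Finset.range N, e k ≤ (1 + 2 / τ + 1 / τ ^ 2) * S := by
    simp only [he, Finset.sum_add_distrib, ← Finset.mul_sum]
    calc _ ≤ S + 2 / τ * S + 1 / τ ^ 2 * S := by
          gcongr
          · exact sE 1 N
          · exact sE 2 N
      _ = _ := by ring
  have h2 : ∑ m ∈ Finset.range N, y m ≤ (2 + τ) * R := by
    simp only [hy, Finset.sum_add_distrib, ← Finset.mul_sum]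
    calc _ ≤ 2 * R + τ * R := by
          gcongr
          · exact sY 1 N
          · exact sY 0 N
      _ = _ := by ring
  have h3 : ∑ m ∈ Finset.range N, y' m ≤ (τ + 1 + 1 / τ + 1 / τ ^ 2) * R := by
    simp only [hy', Finset.sum_add_distrib, ← Finset.mul_sum]
    calc _ ≤ τ * R + R + 1 / τ * R + 1 / τ ^ 2 * R := by
          gcongr
          · exact sY 0 N
          · exact sY 1 N
          · exact sY 2 N
          · exact sY 3 N
      _ = _ := by ring
  calc ∑ n ∈ Finset.range N, Qterm t τ g (I1 t g) n
      ≤ ∑ n ∈ Finset.range N, ∑ c ∈ Finset.HasAntidiagonal.antidiagonal n,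
          128 * (e c.1 * y c.2 + E c.1 * y' c.2) := by
        refine Finset.sum_le_sum fun n _ => (Qterm_I1_le hg ht hL hZ hτ n).trans ?_
        rw [Finset.mul_sum]
        refine Finset.sum_le_sum fun c hc => ?_
        obtain rfl := Finset.HasAntidiagonal.mem_antidiagonal.1 hc
        rw [← mul_assoc]
        exact transport_term_le hτ c.1 c.2
    _ = 128 * (∑ n ∈ Finset.range N, ∑ c ∈ Finset.HasAntidiagonal.antidiagonal n, e c.1 * y c.2 +
          ∑ n ∈ Finset.range N, ∑ c ∈ Finset.HasAntidiagonal.antidiagonal n, E c.1 * y' c.2) := by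
        simp only [← Finset.mul_sum, Finset.sum_add_distrib]
    _ ≤ 128 * ((1 + 2 / τ + 1 / τ ^ 2) * S * ((2 + τ) * R) +
          S * ((τ + 1 + 1 / τ + 1 / τ ^ 2) * R)) := by
        gcongr
        · refine (sum_antidiagonal_mul_le he0 hy0 N).trans ?_
          exact mul_le_mul h1 h2 (Finset.sum_nonneg fun m _ => hy0 m) (by positivity)
        · refine (sum_antidiagonal_mul_le hE0 hy0' N).trans ?_
          exact mul_le_mul h0 h3 (Finset.sum_nonneg fun m _ => hy0' m) hS
    _ = _ := by ring

end assembly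

/-- estimate of the transport term `I₁`. -/
theorem estimate_I1 (τ₀ : ℝ) (hτ₀ : 0 < τ₀) :
    ∃ C : ℝ, 0 < C ∧
      ∀ t : ℝ, 0 ≤ t → ∀ g : ℝ → ℝ → ℝ → ℝ, DecaySmooth g → L2cond t g → L2condZ t g →
        ∀ τ : ℝ, 0 < τ → τ ≤ τ₀ →
          Summable (Xel t τ g) → Summable (Del t τ g) → Summable (Yel t τ g) →
          ∀ N : ℕ,
            (∑ n ∈ Finset.range N, Qterm t τ g (I1 t g) n) ≤
              C / τ ^ 2 * (Xnrm t τ g + Dnrm t τ g) * Ynrm t τ g := by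
  refine ⟨128 * ((τ₀ + 1) ^ 2 * (2 + τ₀) + (τ₀ ^ 3 + τ₀ ^ 2 + τ₀ + 1)), by positivity, ?_⟩
  intro t ht g hg hL hZ τ hτ hτ' hX hD hY N
  refine (sum_Qterm_I1_le hg.1 ht hL hZ hτ hX hD hY N).trans ?_
  have hS : 0 ≤ Xnrm t τ g + Dnrm t τ g := by
    rw [Xnrm, Dnrm, ← hX.tsum_add hD]
    exact tsum_nonneg fun n => XDel_eq t τ g n ▸ XDel_nonneg hτ n
  have hR : 0 ≤ Ynrm t τ g := tsum_nonneg (Yel_nonneg hτ)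
  have h : 128 * ((1 + 2 / τ + 1 / τ ^ 2) * (2 + τ) + (τ + 1 + 1 / τ + 1 / τ ^ 2)) =
      128 * ((τ + 1) ^ 2 * (2 + τ) + (τ ^ 3 + τ ^ 2 + τ + 1)) / τ ^ 2 := by
    field_simp
    ring
  rw [h]
  gcongr
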